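/- arXiv:2310.17859 — 2 statements merged into one kernel-verified Lean document; each statement's English description precedes it below -/
import Mathlib

section
/- Let t ≥ 3, k1 > k2 ≥ ... ≥ kt ≥ 2 and k1 + k3 ≤ n < k1 + k2, and let (ℱ1,...,ℱt) be an extremal (n,k1,...,kt)-cross intersecting system in which every ℱi is L-initial with ID Ii. Then I2 ∈ ℱ_{2,3} and I1 is the k1-parity of I2. -/
open Finset

attribute [local instance] Classical.propDecidable

noncomputable section

/-- The ground set `[n] = {1, …, n}`. -/
def ground (n : ℕ) : Finset ℕ := Finset.Icc 1 n

/-- `C([n], k)`: the family of all `k`-element subsets of `[n]`. -/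
def ksubsets (n k : ℕ) : Finset (Finset ℕ) := Finset.powersetCard k (ground n)

/-- Two families are cross intersecting. -/
def CrossInt (A B : Finset (Finset ℕ)) : Prop :=
  ∀ a ∈ A, ∀ b ∈ B, (a ∩ b).Nonempty

/-- The lexicographic order `A ≺ B`:  `A ⊇ B` or `min (A ∖ B) < min (B ∖ A)`. -/
def lex (A B : Finset ℕ) : Prop :=
  B ⊆ A ∨ (A \ B).min < (B \ A).min

/-- Strict lexicographic order `A ⪵ B`. -/
def lexLT (A B : Finset ℕ) : Prop := lex A B ∧ A ≠ B

/-- `L(R, k)` over `[n]`: all `k`-subsets of `[n]` that are `≺ R`. -/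
def Lset (n : ℕ) (R : Finset ℕ) (k : ℕ) : Finset (Finset ℕ) :=
  (ksubsets n k).filter fun F => lex F R

/-- `L(r, k)`: the first `r` elements of `C([n], k)` in lexicographic order. -/
def Lnum (n r k : ℕ) : Finset (Finset ℕ) :=
  (ksubsets n k).filter fun F => ((ksubsets n k).filter fun G => lex G F).card ≤ r

/-- A family is L-initial if it equals `L(R, k)` for some `k`-set `R` (an ID of the family). -/
def LInitial (n k : ℕ) (A : Finset (Finset ℕ)) : Prop :=
  ∃ R ∈ ksubsets n k, A = Lset n R k

/-- `F` and `H` strongly intersect at their last element; `H` is the partner of `F`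
(and `F` is the partner of `H`). -/
def IsPartner (F H : Finset ℕ) : Prop :=
  ∃ q, F ∩ H = {q} ∧ F ∪ H = Finset.Icc 1 q

/-- `K` is the `k`-partner of `F` (inside `[n]`). -/
def IsKPartner (n k : ℕ) (F K : Finset ℕ) : Prop :=
  ∃ H, IsPartner F H ∧
    ((k = H.card ∧ K = H) ∨
     (H.card < k ∧ K = H ∪ Finset.Icc (n - k + H.card + 1) n) ∨
     (k < H.card ∧ K ∈ ksubsets n k ∧ lex K H ∧
        ∀ K' ∈ ksubsets n k, lex K' H → lex K' K))

/-- `ℓ(F)`: the largest `x` with `{n - x + 1, …, n} ⊆ F` (and `0` if there is none). -/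
def ell (n : ℕ) (F : Finset ℕ) : ℕ :=
  ((Finset.range (n + 1)).filter fun x => Finset.Icc (n - x + 1) n ⊆ F).sup id

/-- `F^t = {n - ℓ(F) + 1, …, n}` (which is `∅` when `ℓ(F) = 0`). -/
def tailPart (n : ℕ) (F : Finset ℕ) : Finset ℕ := Finset.Icc (n - ell n F + 1) n

/-- Maximal cross intersecting families. -/
def MaximalCross (n f g : ℕ) (F G : Finset (Finset ℕ)) : Prop :=
  F ⊆ ksubsets n f ∧ G ⊆ ksubsets n g ∧ CrossInt F G ∧
    ∀ F' G' : Finset (Finset ℕ), F ⊆ F' → F' ⊆ ksubsets n f →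
      G ⊆ G' → G' ⊆ ksubsets n g → CrossInt F' G' → F = F' ∧ G = G'

/-- The pair of sets `(F, G)` is maximal. -/
def PairMaximal (n : ℕ) (F G : Finset ℕ) : Prop :=
  MaximalCross n F.card G.card (Lset n F F.card) (Lset n G G.card)

/-- Maximal pair families. -/
def MaximalPairFamilies (n : ℕ) (A1 A2 : Finset (Finset ℕ)) : Prop :=
  A1.card = A2.card ∧ ∀ a1 ∈ A1, ∃! a2, a2 ∈ A2 ∧ PairMaximal n a1 a2

/-- `H1` is the `|H1|`-parity of `H2` (intended for `|H1| ≤ |H2|`):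
`H1 ∖ H1^t = H2 ∖ H2^t` and `ℓ(H2) - ℓ(H1) = |H2| - |H1|`. -/
def IsParity (n : ℕ) (H1 H2 : Finset ℕ) : Prop :=
  H1 \ tailPart n H1 = H2 \ tailPart n H2 ∧
    ell n H2 + H1.card = ell n H1 + H2.card

/-- The family `H1` of `h1`-sets is the `h1`-parity of the family `H2` of `h2`-sets. -/
def FamParity (n h1 h2 : ℕ) (H1 H2 : Finset (Finset ℕ)) : Prop :=
  (∀ A ∈ H1, ∃ B ∈ ksubsets n h2, IsParity n A B ∧ B ∈ H2) ∧
  (∀ B ∈ H2, ∀ A ∈ ksubsets n h1, IsParity n A B → A ∈ H1)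

/-- An `(n, k 0, …, k (t-1))`-cross intersecting system:  non-empty pairwise
cross intersecting families `F i ⊆ C([n], k i)`. -/
def IsCIS (n : ℕ) {t : ℕ} (k : Fin t → ℕ) (F : Fin t → Finset (Finset ℕ)) : Prop :=
  (∀ i, F i ⊆ ksubsets n (k i)) ∧ (∀ i, (F i).Nonempty) ∧
    ∀ i j : Fin t, i < j → CrossInt (F i) (F j)

/-- An extremal cross intersecting system. -/
def Extremal (n : ℕ) {t : ℕ} (k : Fin t → ℕ) (F : Fin t → Finset (Finset ℕ)) : Prop :=
  IsCIS n k F ∧ ∀ G : Fin t → Finset (Finset ℕ), IsCIS n k G →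
    ∑ i, (G i).card ≤ ∑ i, (F i).card

/-- Two systems of families are isomorphic via a permutation of the ground set `[n]`. -/
def IsoSystems (n : ℕ) {t : ℕ} (F G : Fin t → Finset (Finset ℕ)) : Prop :=
  ∃ σ : Equiv.Perm ℕ, (∀ x ∈ ground n, σ x ∈ ground n) ∧
    ∀ i, F i = (G i).image fun s => s.image ⇑σ

/-- The family `ℛ₂`. -/
def R2fam (n k2 kt : ℕ) : Finset (Finset ℕ) :=
  (ksubsets n k2).filter fun R =>
    lex (insert 1 (Finset.Icc (n - k2 + 2) n)) R ∧
    lex R (insert kt (Finset.Icc (n - k2 + 2) n))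

/-- The family `ℱ₂,₃`. -/
def F23 (n k2 k3 kt : ℕ) : Finset (Finset ℕ) :=
  (R2fam n k2 kt).filter fun A => ∃ B ∈ ksubsets n k3, PairMaximal n A B

/-- The binary weight of a set: `S ⊆ [n]` read as an `n`-digit binary number whose most
significant digit is the one of `1`. -/
def weight (n : ℕ) (S : Finset ℕ) : ℕ := ∑ s ∈ S, 2 ^ (n - s)

theorem weight_mono (n : ℕ) {S T : Finset ℕ} (h : S ⊆ T) : weight n S ≤ weight n T :=
  Finset.sum_le_sum_of_subset h

theorem weight_union (n : ℕ) {S T : Finset ℕ} (h : Disjoint S T) :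
    weight n (S ∪ T) = weight n S + weight n T :=
  Finset.sum_union h

theorem weight_inter_add_sdiff (n : ℕ) (S T : Finset ℕ) :
    weight n (S ∩ T) + weight n (S \ T) = weight n S :=
  Finset.sum_inter_add_sum_sdiff S T _

theorem weight_erase_add (n : ℕ) {S : Finset ℕ} {q : ℕ} (h : q ∈ S) :
    weight n (S.erase q) + 2 ^ (n - q) = weight n S :=
  Finset.sum_erase_add S _ h

theorem two_pow_le_weight (n : ℕ) {S : Finset ℕ} {q : ℕ} (h : q ∈ S) :
    2 ^ (n - q) ≤ weight n S := by
  have := weight_erase_add n h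
  omega

theorem weight_Ioc_add_one {n p : ℕ} (h : p ≤ n) : weight n (Ioc p n) + 1 = 2 ^ (n - p) := by
  obtain ⟨d, rfl⟩ := Nat.exists_eq_add_of_le h
  clear h
  induction d generalizing p with
  | zero => simp [weight]
  | succ d ih =>
    have hI : Ioc p (p + (d + 1)) = insert (p + 1) (Ioc (p + 1) (p + 1 + d)) := by
      ext x
      simp only [mem_Ioc, mem_insert]
      omega
    have h2 := @ih (p + 1)
    rw [hI, weight, sum_insert (by simp)]
    rw [weight, show p + 1 + d - (p + 1) = d by omega] at h2
    rw [show p + (d + 1) = p + 1 + d by omega, show p + 1 + d - (p + 1) = d by omega,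
      show p + 1 + d - p = d + 1 by omega, pow_succ]
    omega

theorem ground_eq_Ioc (n : ℕ) : ground n = Ioc 0 n := by
  ext x
  simp only [ground, mem_Icc, mem_Ioc]
  omega

theorem weight_Icc_add {n q : ℕ} (h : q ≤ n) :
    weight n (Icc 1 q) + 2 ^ (n - q) = 2 ^ n := by
  have h1 := weight_Ioc_add_one (Nat.zero_le n)
  have h2 := weight_Ioc_add_one h
  have h3 : Ioc 0 n = Icc 1 q ∪ Ioc q n := by
    ext x
    simp only [mem_Icc, mem_Ioc, mem_union]
    omega
  have h4 : Disjoint (Icc 1 q) (Ioc q n) := by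
    rw [Finset.disjoint_left]
    intro x
    simp only [mem_Icc, mem_Ioc]
    omega
  rw [h3, weight_union n h4, Nat.sub_zero] at h1
  omega

theorem weight_lt_of_subset_Ioc {n p : ℕ} {S : Finset ℕ} (h : p ≤ n) (hS : S ⊆ Ioc p n) :
    weight n S < 2 ^ (n - p) := by
  have := weight_mono n hS
  have := weight_Ioc_add_one h
  omega

theorem weight_add_lt_of_disjoint {n : ℕ} {S T : Finset ℕ} (hS : S ⊆ ground n)
    (hT : T ⊆ ground n) (h : Disjoint S T) : weight n S + weight n T < 2 ^ n := by
  rw [← weight_union n h]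
  exact weight_lt_of_subset_Ioc (Nat.zero_le n) (by rw [← ground_eq_Ioc]; exact union_subset hS hT)

theorem weight_lt_of_first_diff {n p : ℕ} {A B : Finset ℕ} (hA : A ⊆ ground n)
    (hB : B ⊆ ground n) (hpA : p ∈ A) (hpB : p ∉ B) (h : ∀ x < p, x ∈ B → x ∈ A) :
    weight n B < weight n A := by
  have hp := hA hpA
  simp only [ground, mem_Icc] at hp
  have h1 := weight_inter_add_sdiff n A B
  have h2 := weight_inter_add_sdiff n B A
  have h3 : weight n (B \ A) < 2 ^ (n - p) := by
    refine weight_lt_of_subset_Ioc hp.2 fun x hx => ?_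
    rw [mem_sdiff] at hx
    have hx' := hB hx.1
    simp only [ground, mem_Icc] at hx'
    rw [mem_Ioc]
    refine ⟨?_, hx'.2⟩
    by_contra hlt
    rcases (not_lt.mp hlt).lt_or_eq with hlt | rfl
    · exact hx.2 (h x hlt hx.1)
    · exact hpB hx.1
  have h4 : 2 ^ (n - p) ≤ weight n (A \ B) := two_pow_le_weight n (mem_sdiff.mpr ⟨hpA, hpB⟩)
  rw [inter_comm] at h2
  omega

theorem exists_first_diff {A B : Finset ℕ} (h : A ≠ B) :
    ∃ p, (p ∈ A ∧ p ∉ B ∨ p ∈ B ∧ p ∉ A) ∧ ∀ x < p, (x ∈ A ↔ x ∈ B) := by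
  have hex : ∃ p, ¬(p ∈ A ↔ p ∈ B) := by
    by_contra! hcon
    exact h (Finset.ext hcon)
  refine ⟨Nat.find hex, ?_, fun x hx => not_not.mp (Nat.find_min hex hx)⟩
  have := Nat.find_spec hex
  tauto

theorem exists_first_diff_of_weight_lt {n : ℕ} {A B : Finset ℕ} (hA : A ⊆ ground n)
    (hB : B ⊆ ground n) (h : weight n B < weight n A) :
    ∃ p, p ∈ A ∧ p ∉ B ∧ ∀ x < p, (x ∈ A ↔ x ∈ B) := by
  obtain ⟨p, hp | hp, hlt⟩ := exists_first_diff (A := A) (B := B) (by rintro rfl; omega)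
  · exact ⟨p, hp.1, hp.2, hlt⟩
  · have := weight_lt_of_first_diff hB hA hp.1 hp.2 fun x hx => (hlt x hx).1
    omega

theorem weight_injOn {n : ℕ} {A B : Finset ℕ} (hA : A ⊆ ground n)
    (hB : B ⊆ ground n) (h : weight n A = weight n B) : A = B := by
  by_contra hne
  obtain ⟨p, hp | hp, hlt⟩ := exists_first_diff hne
  · have := weight_lt_of_first_diff hA hB hp.1 hp.2 fun x hx => (hlt x hx).2
    omega
  · have := weight_lt_of_first_diff hB hA hp.1 hp.2 fun x hx => (hlt x hx).1
    omega

theorem lex_iff_weight_le {n : ℕ} {A B : Finset ℕ} (hA : A ⊆ ground n) (hB : B ⊆ ground n) :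
    lex A B ↔ weight n B ≤ weight n A := by
  constructor
  · rintro (h | h)
    · exact weight_mono n h
    · have hne : (A \ B).Nonempty := by
        by_contra hcon
        rw [not_nonempty_iff_eq_empty.mp hcon] at h
        simp at h
      obtain ⟨p, hp⟩ := min_of_nonempty hne
      have hpm := mem_sdiff.mp (mem_of_min hp)
      refine (weight_lt_of_first_diff hA hB hpm.1 hpm.2 fun x hx hxB => ?_).le
      by_contra hxA
      have h1 : (B \ A).min ≤ x := min_le (mem_sdiff.mpr ⟨hxB, hxA⟩)
      rw [hp] at h
      have h2 : p < x := WithTop.coe_lt_coe.mp (lt_of_lt_of_le h h1)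
      omega
  · intro h
    rcases h.lt_or_eq with h | h
    · obtain ⟨p, hpA, hpB, hlt⟩ := exists_first_diff_of_weight_lt hA hB h
      refine Or.inr (lt_of_le_of_lt (min_le (mem_sdiff.mpr ⟨hpA, hpB⟩)) ?_)
      rcases (B \ A).eq_empty_or_nonempty with hBA | hBA
      · rw [hBA, min_empty]
        exact WithTop.coe_lt_top p
      obtain ⟨x, hx⟩ := min_of_nonempty hBA
      have hxm := mem_sdiff.mp (mem_of_min hx)
      rw [hx]
      refine WithTop.coe_lt_coe.mpr ?_
      by_contra hcon
      rcases (not_lt.mp hcon).lt_or_eq with hlt' | rfl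
      · exact hxm.2 ((hlt x hlt').2 hxm.1)
      · exact hxm.2 hpA
    · exact Or.inl (weight_injOn hB hA h).le

theorem two_pow_card_le_weight_add_one {n : ℕ} {S : Finset ℕ} (hS : S ⊆ ground n) :
    2 ^ S.card ≤ weight n S + 1 := by
  induction hk : S.card generalizing S with
  | zero => simp
  | succ c ih =>
    have hne : S.Nonempty := card_pos.mp (by omega)
    set p := S.min' hne with hp
    have hpS : p ∈ S := S.min'_mem hne
    have hp' := hS hpS
    simp only [ground, mem_Icc] at hp'
    have h1 := @ih (S.erase p) ((erase_subset _ _).trans hS) (by rw [card_erase_of_mem hpS]; omega)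
    have h2 := weight_erase_add n hpS
    have h3 : S.card ≤ (Icc p n).card := by
      refine card_le_card fun x hx => ?_
      have hx' := hS hx
      simp only [ground, mem_Icc] at hx'
      exact mem_Icc.mpr ⟨S.min'_le x hx, hx'.2⟩
    rw [Nat.card_Icc] at h3
    have h4 : 2 ^ c ≤ 2 ^ (n - p) := Nat.pow_le_pow_right (by norm_num) (by omega)
    rw [pow_succ]
    omega

theorem weight_prefix {n q : ℕ} (hq : q ≤ n) {S : Finset ℕ} (hS : S ⊆ Icc 1 q) :
    weight n S = 2 ^ (n - q) * weight q S := by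
  rw [weight, weight, mul_sum]
  refine sum_congr rfl fun x hx => ?_
  have := mem_Icc.mp (hS hx)
  rw [← pow_add]
  congr 1
  omega

theorem weight_inter_Icc_add {n q : ℕ} {G : Finset ℕ} (hG : G ⊆ ground n) :
    weight n (G ∩ Icc 1 q) + weight n (G ∩ Ioc q n) = weight n G := by
  rw [← weight_inter_add_sdiff n G (Icc 1 q)]
  congr 2
  ext x
  have : x ∈ G → 1 ≤ x ∧ x ≤ n := fun hx => by simpa [ground] using hG hx
  simp only [mem_inter, mem_Ioc, mem_sdiff, mem_Icc]
  by_cases hx : x ∈ G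
  · have := this hx
    simp only [hx, true_and]
    omega
  · simp [hx]

theorem inter_Icc_eq_iff {n q : ℕ} (hq : q ≤ n) {A G : Finset ℕ} (hA : A ⊆ Icc 1 q)
    (hG : G ⊆ ground n) :
    G ∩ Icc 1 q = A ↔ weight n A ≤ weight n G ∧ weight n G < weight n A + 2 ^ (n - q) := by
  have h1 := weight_inter_Icc_add (q := q) hG
  have h2 : weight n (G ∩ Ioc q n) < 2 ^ (n - q) := weight_lt_of_subset_Ioc hq inter_subset_right
  constructor
  · rintro rfl
    omega
  · rintro ⟨h3, h4⟩
    rw [weight_prefix hq hA] at h3 h4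
    rw [weight_prefix hq inter_subset_right] at h1
    refine weight_injOn (n := q) inter_subset_right hA ?_
    have h5 : weight q A < weight q (G ∩ Icc 1 q) + 1 := by
      refine Nat.lt_of_mul_lt_mul_left (a := 2 ^ (n - q)) ?_
      rw [mul_add, mul_one]
      omega
    have h6 : weight q (G ∩ Icc 1 q) < weight q A + 1 := by
      refine Nat.lt_of_mul_lt_mul_left (a := 2 ^ (n - q)) ?_
      rw [mul_add, mul_one]
      omega
    omega

/-- The `k`-subsets of `[n]` of weight at least `c`. -/
def threshold (n k c : ℕ) : Finset (Finset ℕ) :=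
  (ksubsets n k).filter fun G => c ≤ weight n G

theorem mem_ksubsets {n k : ℕ} {G : Finset ℕ} : G ∈ ksubsets n k ↔ G ⊆ ground n ∧ G.card = k :=
  mem_powersetCard

theorem mem_threshold {n k c : ℕ} {G : Finset ℕ} :
    G ∈ threshold n k c ↔ (G ⊆ ground n ∧ G.card = k) ∧ c ≤ weight n G := by
  rw [threshold, mem_filter, mem_ksubsets]

theorem threshold_subset {n k c c' : ℕ} (h : c' ≤ c) : threshold n k c ⊆ threshold n k c' := by
  intro G hG
  rw [mem_threshold] at hG ⊢
  exact ⟨hG.1, h.trans hG.2⟩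

theorem Lset_eq_threshold {n k : ℕ} {R : Finset ℕ} (hR : R ⊆ ground n) :
    Lset n R k = threshold n k (weight n R) := by
  ext G
  rw [Lset, threshold, mem_filter, mem_filter]
  refine and_congr_right fun hG => ?_
  exact lex_iff_weight_le (mem_ksubsets.mp hG).1 hR

theorem crossInt_threshold {n k k' c c' : ℕ} (h : 2 ^ n ≤ c + c') :
    CrossInt (threshold n k c) (threshold n k' c') := by
  intro a ha b hb
  rw [mem_threshold] at ha hb
  by_contra hcon
  rw [not_nonempty_iff_eq_empty, ← disjoint_iff_inter_eq_empty] at hcon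
  have := weight_add_lt_of_disjoint ha.1.1 hb.1.1 hcon
  omega

/-- A set meeting every `g`-set of weight at least that of `B` has weight at least the
complementary threshold. -/
theorem two_pow_le_weight_add_of_forall_inter {n g : ℕ} {B K : Finset ℕ} (hB : B ⊆ ground n)
    (hBg : B.card ≤ g) (hK : K ⊆ ground n) (hKg : K.card + g ≤ n)
    (h : ∀ G ∈ threshold n g (weight n B), (K ∩ G).Nonempty) :
    2 ^ n ≤ weight n K + weight n B := by
  have hgr : (ground n).card = n := by simp [ground]
  have hW : g ≤ (ground n \ K).card := by
    rw [card_sdiff_of_subset hK, hgr]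
    omega
  obtain ⟨G, hG, hmax⟩ := exists_max_image (powersetCard g (ground n \ K)) (weight n)
    (powersetCard_nonempty.mpr hW)
  rw [mem_powersetCard] at hG
  have hGn : G ⊆ ground n := hG.1.trans sdiff_subset
  have hlt : weight n G < weight n B := by
    by_contra hcon
    obtain ⟨x, hx⟩ := h G (mem_threshold.mpr ⟨⟨hGn, hG.2⟩, not_lt.mp hcon⟩)
    rw [mem_inter] at hx
    exact (mem_sdiff.mp (hG.1 hx.2)).2 hx.1
  obtain ⟨p, hpB, hpG, hp⟩ := exists_first_diff_of_weight_lt hB hGn hlt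
  have hpn := hB hpB
  simp only [ground, mem_Icc] at hpn
  obtain ⟨x, hxG, hxp⟩ : ∃ x ∈ G, p < x := by
    by_contra! hcon
    have hsub : G ⊆ B.erase p := by
      intro x hx
      have hne : x ≠ p := by
        rintro rfl
        exact hpG hx
      exact mem_erase.mpr ⟨hne, (hp x (lt_of_le_of_ne (hcon x hx) hne)).2 hx⟩
    have h1 := card_le_card hsub
    rw [card_erase_of_mem hpB] at h1
    have h2 := card_pos.mpr ⟨p, hpB⟩
    omega
  have hxn := hGn hxG
  simp only [ground, mem_Icc] at hxn
  have hin : ∀ y, 1 ≤ y → y ≤ p → y ∉ G → y ∈ K := by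
    intro y hy1 hyp hyG
    by_contra hyK
    have hyn : y ∈ ground n := by
      simp only [ground, mem_Icc]
      omega
    have hyE : y ∉ G.erase x := fun hy => hyG (mem_of_mem_erase hy)
    have h1 := hmax (insert y (G.erase x)) (by
      rw [mem_powersetCard, card_insert_of_notMem hyE, card_erase_of_mem hxG]
      refine ⟨insert_subset (mem_sdiff.mpr ⟨hyn, hyK⟩) ((erase_subset _ _).trans hG.1), ?_⟩
      have := card_pos.mpr ⟨x, hxG⟩
      omega)
    have h2 := weight_erase_add n hxG
    have h3 : weight n (insert y (G.erase x)) = 2 ^ (n - y) + weight n (G.erase x) :=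
      sum_insert hyE
    have h4 : 2 ^ (n - x) < 2 ^ (n - y) := Nat.pow_lt_pow_right (by norm_num) (by omega)
    omega
  have hpK : p ∈ K := hin p hpn.1 le_rfl hpG
  have hcov : Icc 1 p ⊆ K.erase p ∪ (B \ K.erase p) := by
    intro y hy
    rw [mem_Icc] at hy
    rw [union_sdiff_self_eq_union, mem_union, mem_erase]
    by_cases hyp : y = p
    · exact Or.inr (hyp ▸ hpB)
    · by_cases hyG : y ∈ G
      · exact Or.inr ((hp y (by omega)).2 hyG)
      · exact Or.inl ⟨hyp, hin y hy.1 hy.2 hyG⟩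
  have h1 := weight_mono n hcov
  rw [weight_union n disjoint_sdiff] at h1
  have h2 := weight_mono n (sdiff_subset (s := B) (t := K.erase p))
  have h3 := weight_Icc_add hpn.2
  have h4 := weight_erase_add n hpK
  omega

/-- The number of `k`-sets with a prescribed initial part of size `a`, when `m` elements of the
ground set remain. -/
def extensions (m k a : ℕ) : ℕ := if a ≤ k then m.choose (k - a) else 0

theorem card_filter_inter_Icc {n q k : ℕ} (hq : q ≤ n) {A : Finset ℕ} (hA : A ⊆ Icc 1 q) :
    ((ksubsets n k).filter fun G => G ∩ Icc 1 q = A).card = extensions (n - q) k A.card := by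
  rw [extensions]
  have hsplit : ∀ G ⊆ ground n, G = (G ∩ Icc 1 q) ∪ (G ∩ Ioc q n) := by
    intro G hG
    ext x
    have : x ∈ G → 1 ≤ x ∧ x ≤ n := fun hx => by simpa [ground] using hG hx
    simp only [mem_union, mem_inter, mem_Icc, mem_Ioc]
    constructor
    · intro hx
      have := this hx
      simp only [hx, true_and]
      omega
    · tauto
  have hdisj : Disjoint (Icc 1 q) (Ioc q n) := by
    rw [Finset.disjoint_left]
    intro x
    simp only [mem_Icc, mem_Ioc]
    omega
  split_ifs with hk
  · rw [← Nat.card_Ioc q n, ← card_powersetCard]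
    refine card_nbij' (fun G => G ∩ Ioc q n) (fun S => A ∪ S) ?_ ?_ ?_ ?_
    · intro G hG
      simp only [coe_filter, Set.mem_ofPred_eq, mem_ksubsets] at hG
      have h1 := congrArg card (hsplit G hG.1.1)
      rw [card_union_of_disjoint (hdisj.mono inter_subset_right inter_subset_right), hG.2,
        hG.1.2] at h1
      simp only [mem_coe, mem_powersetCard]
      exact ⟨inter_subset_right, by omega⟩
    · intro S hS
      simp only [mem_coe, mem_powersetCard] at hS
      simp only [coe_filter, Set.mem_ofPred_eq, mem_ksubsets]
      refine ⟨⟨?_, ?_⟩, ?_⟩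
      · rw [ground_eq_Ioc]
        refine union_subset (fun x hx => ?_) (fun x hx => ?_)
        · have := mem_Icc.mp (hA hx)
          exact mem_Ioc.mpr ⟨by omega, by omega⟩
        · have := mem_Ioc.mp (hS.1 hx)
          exact mem_Ioc.mpr ⟨by omega, by omega⟩
      · rw [card_union_of_disjoint (hdisj.mono hA hS.1)]
        omega
      · rw [union_inter_distrib_right, inter_eq_left.mpr hA,
          disjoint_iff_inter_eq_empty.mp (hdisj.symm.mono_left hS.1), union_empty]
    · intro G hG
      simp only [coe_filter, Set.mem_ofPred_eq, mem_ksubsets] at hG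
      rw [← hG.2]
      exact (hsplit G hG.1.1).symm
    · intro S hS
      simp only [mem_coe, mem_powersetCard] at hS
      change (A ∪ S) ∩ Ioc q n = S
      rw [union_inter_distrib_right, inter_eq_left.mpr hS.1,
          disjoint_iff_inter_eq_empty.mp (hdisj.mono_left hA), empty_union]
  · rw [card_eq_zero, filter_eq_empty_iff]
    intro G hG hGA
    have := card_le_card (hGA ▸ inter_subset_left : A ⊆ G)
    rw [(mem_ksubsets.mp hG).2] at this
    omega

theorem card_threshold_weight {n q k : ℕ} (hq : q ≤ n) {A : Finset ℕ} (hA : A ⊆ Icc 1 q) :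
    (threshold n k (weight n A)).card =
      (threshold n k (weight n A + 2 ^ (n - q))).card + extensions (n - q) k A.card := by
  rw [← card_filter_inter_Icc hq hA, ← card_union_of_disjoint]
  · congr 1
    ext G
    rw [mem_union, mem_filter, mem_threshold, mem_threshold, mem_ksubsets]
    by_cases hG : G ⊆ ground n ∧ G.card = k
    · rw [inter_Icc_eq_iff hq hA hG.1]
      simp only [hG, true_and, and_self]
      have : 0 < 2 ^ (n - q) := by positivity
      omega
    · simp [hG]
  · rw [Finset.disjoint_left]
    intro G hG hG'
    rw [mem_threshold] at hG
    rw [mem_filter, inter_Icc_eq_iff hq hA hG.1.1] at hG'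
    omega

theorem subset_ground_of_subset_Icc {n q : ℕ} (hq : q ≤ n) {A : Finset ℕ} (hA : A ⊆ Icc 1 q) :
    A ⊆ ground n :=
  hA.trans (Icc_subset_Icc_right hq)

theorem disjoint_Ioc_of_subset_Icc {n q r : ℕ} (hqr : q ≤ r) {A : Finset ℕ} (hA : A ⊆ Icc 1 q) :
    Disjoint A (Ioc r n) := by
  rw [Finset.disjoint_left]
  intro x hx hx'
  have := mem_Icc.mp (hA hx)
  have := mem_Ioc.mp hx'
  omega

/-- Completing `A` by the last `s` elements of `[n]`. -/
def fill (n s : ℕ) (A : Finset ℕ) : Finset ℕ := A ∪ Ioc (n - s) n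

theorem fill_mem_ksubsets {n q s : ℕ} {A : Finset ℕ} (hA : A ⊆ Icc 1 q) (hs : q + s ≤ n) :
    fill n s A ∈ ksubsets n (A.card + s) := by
  rw [mem_ksubsets, fill, card_union_of_disjoint (disjoint_Ioc_of_subset_Icc (by omega) hA),
    Nat.card_Ioc]
  refine ⟨union_subset (subset_ground_of_subset_Icc (by omega) hA) ?_, by omega⟩
  rw [ground_eq_Ioc]
  exact Ioc_subset_Ioc_left (Nat.zero_le _)

theorem weight_fill {n q s : ℕ} {A : Finset ℕ} (hA : A ⊆ Icc 1 q) (hs : q + s ≤ n) :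
    weight n (fill n s A) + 1 = weight n A + 2 ^ s := by
  rw [fill, weight_union n (disjoint_Ioc_of_subset_Icc (by omega) hA), add_assoc,
    weight_Ioc_add_one (Nat.sub_le _ _), Nat.sub_sub_self (by omega)]

theorem weight_add_two_pow_le {n q c : ℕ} {A G : Finset ℕ} (hG : G ⊆ ground n)
    (hGA : G ∩ Icc 1 q = A) (hc : A.card + c = G.card) :
    weight n A + 2 ^ c ≤ weight n G + 1 := by
  have h1 := weight_inter_Icc_add (q := q) hG
  have h2 := two_pow_card_le_weight_add_one (n := n) (S := G ∩ Ioc q n)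
    (inter_subset_left.trans hG)
  have h3 : c ≤ (G ∩ Ioc q n).card := by
    have hsub : G ⊆ A ∪ (G ∩ Ioc q n) := by
      intro x hx
      have hx' := hG hx
      simp only [ground, mem_Icc] at hx'
      rw [← hGA, mem_union, mem_inter, mem_inter, mem_Icc, mem_Ioc]
      simp only [hx, true_and]
      omega
    have := (card_le_card hsub).trans (card_union_le _ _)
    omega
  have h4 : 2 ^ c ≤ 2 ^ (G ∩ Ioc q n).card := Nat.pow_le_pow_right (by norm_num) h3
  rw [hGA] at h1
  omega

theorem threshold_fill {n q s : ℕ} {A : Finset ℕ} (hA : A ⊆ Icc 1 q) (hs : q + s ≤ n) :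
    threshold n (A.card + s) (weight n (fill n s A)) = threshold n (A.card + s) (weight n A) := by
  have hw := weight_fill hA hs
  have hpos : 1 ≤ 2 ^ s := Nat.one_le_two_pow
  refine (threshold_subset (by omega)).antisymm fun G hG => ?_
  rw [mem_threshold] at hG ⊢
  refine ⟨hG.1, ?_⟩
  by_cases hlt : weight n G < weight n A + 2 ^ (n - q)
  · have := weight_add_two_pow_le hG.1.1
      ((inter_Icc_eq_iff (by omega) hA hG.1.1).mpr ⟨hG.2, hlt⟩) hG.1.2.symm
    omega
  · have : 2 ^ s ≤ 2 ^ (n - q) := Nat.pow_le_pow_right (by norm_num) (by omega)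
    omega

theorem weight_le_weight_Icc_card {n : ℕ} {G : Finset ℕ} (hG : G ⊆ ground n) :
    weight n G ≤ weight n (Icc 1 G.card) := by
  have hGn : G.card ≤ n := by simpa [ground] using card_le_card hG
  by_contra hcon
  obtain ⟨p, hpG, hp, hlt⟩ := exists_first_diff_of_weight_lt hG
    (subset_ground_of_subset_Icc hGn subset_rfl) (not_le.mp hcon)
  have hpn := hG hpG
  simp only [ground, mem_Icc] at hpn
  rw [mem_Icc] at hp
  have hsub : insert p (Icc 1 G.card) ⊆ G := by
    refine insert_subset hpG fun x hx => (hlt x ?_).2 hx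
    rw [mem_Icc] at hx
    omega
  have := card_le_card hsub
  rw [card_insert_of_notMem (by rwa [mem_Icc]), Nat.card_Icc] at this
  omega

/-- The partner of `B ⊆ [q]` when `q ∈ B`. -/
def partner (q : ℕ) (B : Finset ℕ) : Finset ℕ := Icc 1 q \ B.erase q

theorem partner_subset (q : ℕ) (B : Finset ℕ) : partner q B ⊆ Icc 1 q := sdiff_subset

theorem mem_partner {q : ℕ} {B : Finset ℕ} (hq : q ∈ B) (hB : B ⊆ Icc 1 q) : q ∈ partner q B := by
  simp [partner, hB hq]

theorem card_partner_add {q : ℕ} {B : Finset ℕ} (hq : q ∈ B) (hB : B ⊆ Icc 1 q) :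
    (partner q B).card + B.card = q + 1 := by
  have h1 := card_le_card ((erase_subset q B).trans hB)
  have h2 := card_pos.mpr ⟨q, hq⟩
  rw [partner, card_sdiff_of_subset ((erase_subset _ _).trans hB)]
  rw [card_erase_of_mem hq, Nat.card_Icc] at *
  omega

theorem weight_partner_add {n q : ℕ} {B : Finset ℕ} (hqn : q ≤ n) (hq : q ∈ B)
    (hB : B ⊆ Icc 1 q) : weight n (partner q B) + weight n B = 2 ^ n := by
  have h1 := weight_inter_add_sdiff n (Icc 1 q) (B.erase q)
  rw [inter_eq_right.mpr ((erase_subset _ _).trans hB)] at h1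
  have h2 := weight_erase_add n hq
  have h3 := weight_Icc_add hqn
  rw [partner]
  omega

theorem extensions_mul_le {n q k k' a b : ℕ} (ha : 1 ≤ a) (hb : 1 ≤ b)
    (hab : a + b = q + 1) (hk : k + k' ≤ n) :
    extensions (n - q) k a * extensions (n - q) k' b ≤
      extensions (n - q) k (a - 1) * extensions (n - q) k' (b - 1) := by
  by_cases hak : a ≤ k
  · by_cases hbk : b ≤ k'
    · obtain ⟨x, rfl⟩ := Nat.exists_eq_add_of_le hak
      obtain ⟨y, rfl⟩ := Nat.exists_eq_add_of_le hbk
      rw [extensions, extensions, extensions, extensions, if_pos hak, if_pos hbk,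
        if_pos (by omega), if_pos (by omega), show a + x - a = x by omega,
        show b + y - b = y by omega, show a + x - (a - 1) = x + 1 by omega,
        show b + y - (b - 1) = y + 1 by omega]
      have hx := Nat.choose_succ_right_eq (n - q) x
      have hy := Nat.choose_succ_right_eq (n - q) y
      have h1 : y + 1 ≤ n - q - x := by omega
      have h2 : x + 1 ≤ n - q - y := by omega
      refine Nat.le_of_mul_le_mul_right (c := (x + 1) * (y + 1)) ?_ (by positivity)
      calc (n - q).choose x * (n - q).choose y * ((x + 1) * (y + 1))
          = (n - q).choose x * (n - q).choose y * ((y + 1) * (x + 1)) := by ring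
        _ ≤ (n - q).choose x * (n - q).choose y * ((n - q - x) * (n - q - y)) := by gcongr
        _ = ((n - q).choose x * (n - q - x)) * ((n - q).choose y * (n - q - y)) := by ring
        _ = ((n - q).choose (x + 1) * (x + 1)) * ((n - q).choose (y + 1) * (y + 1)) := by
          rw [hx, hy]
        _ = (n - q).choose (x + 1) * (n - q).choose (y + 1) * ((x + 1) * (y + 1)) := by ring
    · simp [extensions, hbk]
  · simp [extensions, hak]

theorem extensions_pos {m k a : ℕ} (ha : a ≤ k) (hm : k - a ≤ m) : 0 < extensions m k a := by
  rw [extensions, if_pos ha]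
  exact Nat.choose_pos hm

theorem card_threshold_shift {n q : ℕ} {B : Finset ℕ} (hqn : q ≤ n) (hq : q ∈ B)
    (hB : B ⊆ Icc 1 q) (k : ℕ) :
    (threshold n k (weight n B)).card = (threshold n k (weight n B + 2 ^ (n - q))).card +
        extensions (n - q) k B.card ∧
      (threshold n k (weight n B - 2 ^ (n - q))).card = (threshold n k (weight n B)).card +
        extensions (n - q) k (B.card - 1) := by
  have h1 := weight_erase_add n hq
  refine ⟨card_threshold_weight hqn hB, ?_⟩
  have h2 := card_threshold_weight (k := k) hqn ((erase_subset q B).trans hB)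
  rw [h1, card_erase_of_mem hq] at h2
  rw [← h2]
  congr 2
  omega

theorem one_mem_of_two_pow_le_weight {n : ℕ} {G : Finset ℕ} (hn : 1 ≤ n) (hG : G ⊆ ground n)
    (h : 2 ^ (n - 1) ≤ weight n G) : 1 ∈ G := by
  by_contra hcon
  have : G ⊆ Ioc 1 n := by
    intro x hx
    have hx' := hG hx
    simp only [ground, mem_Icc] at hx'
    have : x ≠ 1 := by
      rintro rfl
      exact hcon hx
    rw [mem_Ioc]
    omega
  have := weight_lt_of_subset_Ioc hn this
  omega

/-- Removing the final run of `[n]` from a proper subset containing `1`. -/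
theorem exists_eq_fill {n : ℕ} {G : Finset ℕ} (hG : G ⊆ ground n) (h1 : 1 ∈ G)
    (hn : G.card < n) :
    ∃ q B, q ∈ B ∧ B ⊆ Icc 1 q ∧ B.card ≤ G.card ∧ q + (G.card - B.card) < n ∧
      G = fill n (G.card - B.card) B ∧ 1 ∈ B := by
  have hne : (ground n \ G).Nonempty := by
    rw [← card_pos, card_sdiff_of_subset hG]
    simp only [ground, Nat.card_Icc]
    omega
  set r := (ground n \ G).max' hne with hr
  have hrm := mem_sdiff.mp ((ground n \ G).max'_mem hne)
  rw [← hr] at hrm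
  have hrn := hrm.1
  simp only [ground, mem_Icc] at hrn
  have hmax : ∀ x, r < x → x ≤ n → x ∈ G := by
    intro x hx hxn
    by_contra hcon
    have : x ≤ r := le_max' _ _ (mem_sdiff.mpr ⟨by simp only [ground, mem_Icc]; omega, hcon⟩)
    omega
  have h1B : 1 ∈ G ∩ Icc 1 r := mem_inter.mpr ⟨h1, mem_Icc.mpr ⟨le_rfl, hrn.1⟩⟩
  set q := (G ∩ Icc 1 r).max' ⟨1, h1B⟩ with hq
  have hqm := (G ∩ Icc 1 r).max'_mem ⟨1, h1B⟩
  rw [← hq] at hqm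
  have hqm' := mem_inter.mp hqm
  have hqr : q < r := by
    refine lt_of_le_of_ne (mem_Icc.mp hqm'.2).2 ?_
    rintro heq
    exact hrm.2 (heq ▸ hqm'.1)
  have hdisj : Disjoint (G ∩ Icc 1 r) (Ioc r n) := disjoint_Ioc_of_subset_Icc le_rfl
    inter_subset_right
  have hGeq : G = (G ∩ Icc 1 r) ∪ Ioc r n := by
    ext x
    have hx' : x ∈ G → 1 ≤ x ∧ x ≤ n := fun hx => by simpa [ground] using hG hx
    simp only [mem_union, mem_inter, mem_Icc, mem_Ioc]
    constructor
    · intro hx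
      have := hx' hx
      simp only [hx, true_and]
      omega
    · rintro (hx | hx)
      · exact hx.1
      · exact hmax x hx.1 hx.2
  have hcard := congrArg card hGeq
  rw [card_union_of_disjoint hdisj, Nat.card_Ioc] at hcard
  refine ⟨q, G ∩ Icc 1 r, hqm, fun x hx => ?_, card_le_card inter_subset_left, by omega, ?_, h1B⟩
  · exact mem_Icc.mpr ⟨(mem_Icc.mp (mem_inter.mp hx).2).1, le_max' _ _ hx⟩
  · rw [fill, show n - (G.card - (G ∩ Icc 1 r).card) = r by omega]
    exact hGeq

/-- The parameter range in which only the first two families intersect for free. -/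
structure Regime (n : ℕ) {t : ℕ} (k : Fin t → ℕ) (i₀ i₁ : Fin t) : Prop where
  val_zero : i₀.val = 0
  val_one : i₁.val = 1
  three_le : 3 ≤ t
  anti : ∀ i j : Fin t, i ≤ j → k j ≤ k i
  lt : k i₁ < k i₀
  two_le : ∀ i, 2 ≤ k i
  room : ∀ i j : Fin t, 2 ≤ j.val → k i + k j ≤ n
  big : n < k i₀ + k i₁

theorem Regime.card_lt {n t : ℕ} {k : Fin t → ℕ} {i₀ i₁ : Fin t} (h : Regime n k i₀ i₁)
    (i : Fin t) : k i < n := by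
  have h1 := h.room i ⟨2, h.three_le⟩ le_rfl
  have h2 := h.two_le ⟨2, h.three_le⟩
  omega

theorem Regime.eq_of_val_lt {n t : ℕ} {k : Fin t → ℕ} {i₀ i₁ : Fin t} (h : Regime n k i₀ i₁)
    {i : Fin t} (hi : i.val < 2) : i = i₀ ∨ i = i₁ := by
  have h0 := h.val_zero
  have h1 := h.val_one
  rw [Fin.ext_iff, Fin.ext_iff]
  omega

/-- The system given by a threshold `c`: the first two families use the complementary
threshold. -/
def thresholdSystem (n : ℕ) {t : ℕ} (k : Fin t → ℕ) (c : ℕ) : Fin t → Finset (Finset ℕ) :=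
  fun i => if i.val < 2 then threshold n (k i) (2 ^ n - c) else threshold n (k i) c

theorem thresholdSystem_of_lt (n : ℕ) {t : ℕ} (k : Fin t → ℕ) (c : ℕ) {i : Fin t}
    (hi : i.val < 2) : thresholdSystem n k c i = threshold n (k i) (2 ^ n - c) := if_pos hi

theorem thresholdSystem_of_le (n : ℕ) {t : ℕ} (k : Fin t → ℕ) (c : ℕ) {i : Fin t}
    (hi : 2 ≤ i.val) : thresholdSystem n k c i = threshold n (k i) c := if_neg (by omega)

/-- The thresholds for which the threshold system is cross intersecting. -/
def ValidThreshold (n : ℕ) {t : ℕ} (k : Fin t → ℕ) (c : ℕ) : Prop :=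
  2 ^ (n - 1) ≤ c ∧ ∀ i : Fin t, 2 ≤ i.val → (threshold n (k i) c).Nonempty

theorem two_pow_eq {n : ℕ} (hn : 1 ≤ n) : 2 ^ n = 2 ^ (n - 1) + 2 ^ (n - 1) := by
  obtain ⟨m, rfl⟩ := Nat.exists_eq_add_of_le' hn
  rw [Nat.add_sub_cancel, pow_succ]
  omega

theorem Icc_mem_ksubsets {n k : ℕ} (h : k ≤ n) : Icc 1 k ∈ ksubsets n k := by
  rw [mem_ksubsets]
  exact ⟨subset_ground_of_subset_Icc h subset_rfl, by simp⟩

theorem isCIS_thresholdSystem {n t : ℕ} {k : Fin t → ℕ} {i₀ i₁ : Fin t} (h : Regime n k i₀ i₁)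
    {c : ℕ} (hc : ValidThreshold n k c) : IsCIS n k (thresholdSystem n k c) := by
  have hn : 1 ≤ n := by have := h.card_lt i₀; omega
  have h2 := two_pow_eq hn
  refine ⟨fun i => ?_, fun i => ?_, fun i j hij => ?_⟩
  · rw [thresholdSystem]
    split_ifs <;> exact filter_subset _ _
  · by_cases hi : i.val < 2
    · rw [thresholdSystem_of_lt n k c hi]
      have hk := h.two_le i
      refine ⟨Icc 1 (k i), mem_threshold.mpr ⟨mem_ksubsets.mp (Icc_mem_ksubsets (h.card_lt i).le),
        ?_⟩⟩
      have : 2 ^ (n - 1) ≤ weight n (Icc 1 (k i)) :=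
        two_pow_le_weight n (mem_Icc.mpr ⟨le_rfl, by omega⟩)
      have := hc.1
      omega
    · rw [thresholdSystem_of_le n k c (by omega)]
      exact hc.2 i (by omega)
  · by_cases hi : i.val < 2
    · by_cases hj : j.val < 2
      · obtain rfl : i = i₀ := by
          have := h.val_zero
          have := Fin.lt_def.mp hij
          exact Fin.ext (by omega)
        obtain rfl : j = i₁ := by
          have := h.val_one
          have := Fin.lt_def.mp hij
          exact Fin.ext (by omega)
        rw [thresholdSystem_of_lt n k c hi, thresholdSystem_of_lt n k c hj]
        intro a ha b hb
        rw [mem_threshold] at ha hb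
        by_contra hcon
        rw [not_nonempty_iff_eq_empty, ← disjoint_iff_inter_eq_empty] at hcon
        have h3 := card_le_card (union_subset ha.1.1 hb.1.1)
        rw [card_union_of_disjoint hcon, ha.1.2, hb.1.2] at h3
        simp only [ground, Nat.card_Icc] at h3
        have := h.big
        omega
      · rw [thresholdSystem_of_lt n k c hi, thresholdSystem_of_le n k c (by omega)]
        exact crossInt_threshold (by omega)
    · have := Fin.lt_def.mp hij
      rw [thresholdSystem_of_le n k c (by omega), thresholdSystem_of_le n k c (by omega)]
      have := hc.1
      exact crossInt_threshold (by omega)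

theorem Extremal.eq_of_subset {n t : ℕ} {k : Fin t → ℕ} {F G : Fin t → Finset (Finset ℕ)}
    (hF : Extremal n k F) (hG : IsCIS n k G) (h : ∀ i, F i ⊆ G i) : F = G := by
  funext i
  refine eq_of_subset_of_card_le (h i) ?_
  by_contra hcon
  have := hF.2 G hG
  have : ∑ i, (F i).card < ∑ i, (G i).card :=
    sum_lt_sum (fun i _ => card_le_card (h i)) ⟨i, mem_univ i, not_le.mp hcon⟩
  omega

theorem sum_thresholdSystem {n t : ℕ} {k : Fin t → ℕ} {i₀ i₁ : Fin t} (h : Regime n k i₀ i₁)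
    (c : ℕ) : ∑ i, (thresholdSystem n k c i).card =
      (threshold n (k i₀) (2 ^ n - c)).card + (threshold n (k i₁) (2 ^ n - c)).card +
        ∑ i with 2 ≤ i.val, (threshold n (k i) c).card := by
  have h0 := h.val_zero
  have h1 := h.val_one
  have hne : i₀ ≠ i₁ := by
    rintro rfl
    omega
  rw [← sum_filter_add_sum_filter_not univ (fun i : Fin t => i.val < 2)]
  congr 1
  · have : (univ.filter fun i : Fin t => i.val < 2) = {i₀, i₁} := by
      ext i
      simp only [mem_filter, mem_univ, true_and, mem_insert, mem_singleton]
      constructor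
      · exact h.eq_of_val_lt
      · rintro (rfl | rfl) <;> omega
    rw [this, sum_pair hne, thresholdSystem_of_lt n k c (by omega),
      thresholdSystem_of_lt n k c (by omega)]
  · simp only [not_lt]
    exact sum_congr rfl fun i hi => by
      rw [thresholdSystem_of_le n k c (mem_filter.mp hi).2]

/-- A threshold whose system is extremal. -/
def OptimalThreshold (n : ℕ) {t : ℕ} (k : Fin t → ℕ) (c : ℕ) : Prop :=
  ValidThreshold n k c ∧ Extremal n k (thresholdSystem n k c)

/-- `B` is the ID of a threshold family of `k j`-sets, stripped of its final run. -/
structure StrippedID (n : ℕ) {t : ℕ} (k : Fin t → ℕ) (j : Fin t) (q : ℕ) (B : Finset ℕ) :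
    Prop where
  two_le : 2 ≤ j.val
  mem : q ∈ B
  subset : B ⊆ Icc 1 q
  card_le : B.card ≤ k j
  room : q + (k j - B.card) < n

theorem thresholdSystem_subset_of_stripped {n t : ℕ} {k : Fin t → ℕ} {i₀ i₁ : Fin t}
    (h : Regime n k i₀ i₁) {c : ℕ} {j : Fin t} {q : ℕ} {B : Finset ℕ}
    (hB : StrippedID n k j q B) (hj : threshold n (k j) (weight n B) ⊆ threshold n (k j) c)
    (hle : ∀ i : Fin t, 2 ≤ i.val → ∀ G ∈ threshold n (k i) c, weight n B ≤ weight n G)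
    (i : Fin t) : thresholdSystem n k c i ⊆ thresholdSystem n k (weight n B) i := by
  have hr := hB.room
  have hBn := subset_ground_of_subset_Icc (n := n) (by omega) hB.subset
  intro K hK
  by_cases hi : i.val < 2
  · rw [thresholdSystem_of_lt n k _ hi] at hK ⊢
    have hK' := mem_threshold.mp hK
    refine mem_threshold.mpr ⟨hK'.1, ?_⟩
    have := two_pow_le_weight_add_of_forall_inter hBn hB.card_le hK'.1.1
      (by rw [hK'.1.2]; exact h.room i j hB.two_le)
      fun G hG => crossInt_threshold (by omega) K hK G (hj hG)
    omega
  · rw [thresholdSystem_of_le n k _ (by omega)] at hK ⊢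
    exact mem_threshold.mpr ⟨(mem_threshold.mp hK).1, hle i (by omega) K hK⟩

theorem OptimalThreshold.exists_strippedID {n t : ℕ} {k : Fin t → ℕ} {i₀ i₁ : Fin t}
    (h : Regime n k i₀ i₁) {c : ℕ} (hc : OptimalThreshold n k c) :
    ∃ j q B, StrippedID n k j q B ∧ OptimalThreshold n k (weight n B) ∧
      thresholdSystem n k (weight n B) = thresholdSystem n k c := by
  have hJ : ∀ i : Fin t, ∃ J, 2 ≤ i.val →
      J ∈ threshold n (k i) c ∧ ∀ G ∈ threshold n (k i) c, weight n J ≤ weight n G := by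
    intro i
    by_cases hi : 2 ≤ i.val
    · obtain ⟨J, hJ⟩ := exists_min_image _ (weight n) (hc.1.2 i hi)
      exact ⟨J, fun _ => hJ⟩
    · exact ⟨∅, fun hi' => absurd hi' hi⟩
  choose J hJ using hJ
  obtain ⟨j, hj, hjmin⟩ := exists_min_image (univ.filter fun i : Fin t => 2 ≤ i.val)
    (fun i => weight n (J i)) ⟨⟨2, h.three_le⟩, by simp⟩
  have hj2 := (mem_filter.mp hj).2
  obtain ⟨hJj, hJmin⟩ := hJ j hj2
  have hJj' := mem_threshold.mp hJj
  have hn : 1 ≤ n := by have := h.card_lt i₀; omega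
  obtain ⟨q, B, hqB, hBq, hBc, hroom, hfill, h1B⟩ := exists_eq_fill hJj'.1.1
    (one_mem_of_two_pow_le_weight hn hJj'.1.1 (hc.1.1.trans hJj'.2))
    (by rw [hJj'.1.2]; exact h.card_lt j)
  rw [hJj'.1.2] at hBc hroom hfill
  have hB : StrippedID n k j q B := ⟨hj2, hqB, hBq, hBc, hroom⟩
  have hBJ : weight n B ≤ weight n (J j) := by
    rw [hfill]
    exact weight_mono n subset_union_left
  have hth : threshold n (k j) (weight n B) ⊆ threshold n (k j) c := by
    have := threshold_fill hBq (s := k j - B.card) hroom.le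
    rw [← hfill, Nat.add_sub_cancel' hBc] at this
    rw [← this]
    exact threshold_subset hJj'.2
  have hsub := thresholdSystem_subset_of_stripped h hB hth fun i hi G hG =>
    hBJ.trans ((hjmin i (by simpa using hi)).trans ((hJ i hi).2 G hG))
  have hvalid : ValidThreshold n k (weight n B) := by
    refine ⟨two_pow_le_weight n h1B, fun i hi => ?_⟩
    have := hsub i
    rw [thresholdSystem_of_le n k _ hi, thresholdSystem_of_le n k _ hi] at this
    exact (hc.1.2 i hi).mono this
  have heq := hc.2.eq_of_subset (isCIS_thresholdSystem h hvalid) hsub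
  exact ⟨j, q, B, hB, ⟨hvalid, heq ▸ hc.2⟩, heq.symm⟩

theorem StrippedID.one_mem {n t : ℕ} {k : Fin t → ℕ} {j : Fin t} {q : ℕ} {B : Finset ℕ}
    (hB : StrippedID n k j q B) (hc : ValidThreshold n k (weight n B)) : 1 ∈ B := by
  have hr := hB.room
  exact one_mem_of_two_pow_le_weight (by omega)
    (subset_ground_of_subset_Icc (by omega) hB.subset) hc.1

theorem StrippedID.valid_sub {n t : ℕ} {k : Fin t → ℕ} {j : Fin t} {q : ℕ} {B : Finset ℕ}
    (hB : StrippedID n k j q B) (hc : ValidThreshold n k (weight n B)) (hq : 1 < q) :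
    ValidThreshold n k (weight n B - 2 ^ (n - q)) := by
  have h1 := weight_erase_add n hB.mem
  refine ⟨?_, fun i hi => (hc.2 i hi).mono (threshold_subset (Nat.sub_le _ _))⟩
  have : 2 ^ (n - 1) ≤ weight n (B.erase q) :=
    two_pow_le_weight n (mem_erase.mpr ⟨by omega, hB.one_mem hc⟩)
  omega

theorem StrippedID.valid_add {n t : ℕ} {k : Fin t → ℕ} {i₀ i₁ : Fin t}
    (h : Regime n k i₀ i₁) {j : Fin t} {q : ℕ} {B : Finset ℕ}
    (hB : StrippedID n k j q B) (hc : ValidThreshold n k (weight n B))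
    (hq : 1 < (partner q B).card) :
    ValidThreshold n k (weight n B + 2 ^ (n - q)) := by
  have hr := hB.room
  refine ⟨hc.1.trans (Nat.le_add_right _ _), fun i hi => ?_⟩
  obtain ⟨G, hG⟩ := hc.2 i hi
  rw [mem_threshold] at hG
  have hk := mem_ksubsets.mp (Icc_mem_ksubsets (h.card_lt i).le)
  refine ⟨Icc 1 (k i), mem_threshold.mpr ⟨hk, ?_⟩⟩
  by_contra hcon
  have h1 := weight_le_weight_Icc_card hG.1.1
  rw [hG.1.2] at h1
  have h2 := (inter_Icc_eq_iff (by omega) hB.subset hk.1).mpr ⟨hG.2.trans h1, not_le.mp hcon⟩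
  have h3 : q ∈ Icc 1 (k i) ∩ Icc 1 q := h2 ▸ hB.mem
  have h4 : q ≤ k i := (mem_Icc.mp (mem_inter.mp h3).1).2
  rw [inter_eq_right.mpr (Icc_subset_Icc_right h4)] at h2
  have h5 := card_partner_add hB.mem hB.subset
  have h6 := congrArg card h2
  rw [Nat.card_Icc] at h6
  omega

/-- When the partner of the stripped ID is too large for the second family, raising the
threshold keeps the system extremal, fixes the second family and enlarges the first one. -/
theorem OptimalThreshold.add_two_pow {n t : ℕ} {k : Fin t → ℕ} {i₀ i₁ : Fin t}
    (h : Regime n k i₀ i₁) {j : Fin t} {q : ℕ} {B : Finset ℕ}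
    (hB : StrippedID n k j q B) (hc : OptimalThreshold n k (weight n B))
    (hlt : k i₁ < (partner q B).card) :
    OptimalThreshold n k (weight n B + 2 ^ (n - q)) ∧
      (threshold n (k i₁) (2 ^ n - (weight n B + 2 ^ (n - q)))).card =
        (threshold n (k i₁) (2 ^ n - weight n B)).card ∧
      (threshold n (k i₀) (2 ^ n - weight n B)).card <
        (threshold n (k i₀) (2 ^ n - (weight n B + 2 ^ (n - q)))).card := by
  have hr := hB.room
  have hbk := hB.card_le
  have hqn : q ≤ n := by omega
  have hk1 := h.two_le i₁
  have hb : 1 ≤ B.card := card_pos.mpr ⟨q, hB.mem⟩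
  have hcard := card_partner_add hB.mem hB.subset
  have hsum := weight_partner_add hqn hB.mem hB.subset
  have hqH := mem_partner hB.mem hB.subset
  have hwB : 2 ^ (n - q) ≤ weight n B := two_pow_le_weight n hB.mem
  have hwH : 2 ^ (n - q) ≤ weight n (partner q B) := two_pow_le_weight n hqH
  have hpos : 0 < 2 ^ (n - q) := by positivity
  have hval := hB.valid_add h hc.1 (by omega)
  have hdown := hc.2.2 _ (isCIS_thresholdSystem h (hB.valid_sub hc.1 (by omega)))
  have hup := hc.2.2 _ (isCIS_thresholdSystem h hval)
  have hsB := fun i => card_threshold_shift hqn hB.mem hB.subset (k i)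
  have hsH := fun i => card_threshold_shift hqn hqH (partner_subset q B) (k i)
  rw [show weight n (partner q B) - 2 ^ (n - q) = 2 ^ n - (weight n B + 2 ^ (n - q)) by omega,
    show weight n (partner q B) + 2 ^ (n - q) = 2 ^ n - (weight n B - 2 ^ (n - q)) by omega,
    show weight n (partner q B) = 2 ^ n - weight n B by omega] at hsH
  have hsumU := sum_thresholdSystem h (weight n B + 2 ^ (n - q))
  have hsumD := sum_thresholdSystem h (weight n B - 2 ^ (n - q))
  have hsum0 := sum_thresholdSystem h (weight n B)
  rw [hsum0, hsumD] at hdown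
  have hD : ∑ i with 2 ≤ i.val, (threshold n (k i) (weight n B - 2 ^ (n - q))).card =
      ∑ i with 2 ≤ i.val, (threshold n (k i) (weight n B)).card +
        ∑ i with 2 ≤ i.val, extensions (n - q) (k i) (B.card - 1) := by
    rw [← sum_add_distrib]
    exact sum_congr rfl fun i _ => (hsB i).2
  have hU : ∑ i with 2 ≤ i.val, (threshold n (k i) (weight n B)).card =
      ∑ i with 2 ≤ i.val, (threshold n (k i) (weight n B + 2 ^ (n - q))).card +
        ∑ i with 2 ≤ i.val, extensions (n - q) (k i) B.card := by
    rw [← sum_add_distrib]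
    exact sum_congr rfl fun i _ => (hsB i).1
  have hj : j ∈ univ.filter fun i : Fin t => 2 ≤ i.val := by simpa using hB.two_le
  have hS : 1 ≤ ∑ i with 2 ≤ i.val, extensions (n - q) (k i) B.card :=
    (extensions_pos (m := n - q) hbk (by omega)).trans_le
      (single_le_sum (f := fun i => extensions (n - q) (k i) B.card)
        (fun _ _ => Nat.zero_le _) hj)
  have hS' : 1 ≤ ∑ i with 2 ≤ i.val, extensions (n - q) (k i) (B.card - 1) :=
    (extensions_pos (m := n - q) (k := k j) (a := B.card - 1) (by omega) (by omega)).trans_le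
      (single_le_sum (f := fun i => extensions (n - q) (k i) (B.card - 1))
        (fun _ _ => Nat.zero_le _) hj)
  have hprod : (∑ i with 2 ≤ i.val, extensions (n - q) (k i) B.card) *
      extensions (n - q) (k i₀) (partner q B).card ≤
      (∑ i with 2 ≤ i.val, extensions (n - q) (k i) (B.card - 1)) *
        extensions (n - q) (k i₀) ((partner q B).card - 1) := by
    rw [sum_mul, sum_mul]
    refine sum_le_sum fun i hi => extensions_mul_le hb (by omega) (by omega) ?_
    rw [add_comm]
    exact h.room i₀ i (mem_filter.mp hi).2
  have hx1 : extensions (n - q) (k i₁) (partner q B).card = 0 := if_neg (by omega)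
  obtain ⟨h1D, h1U⟩ := hsH i₁
  obtain ⟨h0D, h0U⟩ := hsH i₀
  rw [hsum0, hsumU] at hup
  generalize extensions (n - q) (k i₀) (partner q B).card = X at *
  generalize extensions (n - q) (k i₀) ((partner q B).card - 1) = X' at *
  generalize ∑ i with 2 ≤ i.val, extensions (n - q) (k i) B.card = S at *
  generalize ∑ i with 2 ≤ i.val, extensions (n - q) (k i) (B.card - 1) = S' at *
  have hS'X : S' ≤ X := by omega
  have hSX' : S ≤ X' := by
    refine Nat.le_of_mul_le_mul_right (c := X) ?_ (by omega)
    calc S * X ≤ S' * X' := hprod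
      _ ≤ X * X' := Nat.mul_le_mul_right _ hS'X
      _ = X' * X := mul_comm _ _
  refine ⟨⟨hval, isCIS_thresholdSystem h hval, fun G hG => (hc.2.2 G hG).trans ?_⟩, ?_, ?_⟩
  · rw [hsum0, hsumU]
    omega
  · omega
  · omega

theorem OptimalThreshold.lt_two_pow {n t : ℕ} {k : Fin t → ℕ} {i₀ i₁ : Fin t}
    (h : Regime n k i₀ i₁) {c : ℕ} (hc : OptimalThreshold n k c) : c < 2 ^ n := by
  obtain ⟨G, hG⟩ := hc.1.2 ⟨2, h.three_le⟩ le_rfl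
  rw [mem_threshold, ground_eq_Ioc] at hG
  have := weight_lt_of_subset_Ioc (Nat.zero_le n) hG.1.1
  rw [Nat.sub_zero] at this
  omega

/-- The partner of a stripped ID of an extremal threshold system fits into the second family. -/
theorem OptimalThreshold.card_partner_le {n t : ℕ} {k : Fin t → ℕ} {i₀ i₁ : Fin t}
    (h : Regime n k i₀ i₁) {j : Fin t} {q : ℕ} {B : Finset ℕ}
    (hB : StrippedID n k j q B) (hc : OptimalThreshold n k (weight n B)) :
    (partner q B).card ≤ k i₁ := by
  set N : Fin t → ℕ → ℕ := fun i c => (threshold n (k i) (2 ^ n - c)).card with hN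
  set P : Finset ℕ := (range (2 ^ n)).filter fun c =>
    OptimalThreshold n k c ∧ N i₁ c = N i₁ (weight n B) with hP
  have hmemP : ∀ c, c ∈ P ↔ OptimalThreshold n k c ∧ N i₁ c = N i₁ (weight n B) := by
    intro c
    rw [hP, mem_filter, mem_range]
    exact ⟨fun hc => hc.2, fun hc => ⟨hc.1.lt_two_pow h, hc⟩⟩
  obtain ⟨d, hd, hdmax⟩ := exists_max_image P (N i₀) ⟨_, (hmemP _).mpr ⟨hc, rfl⟩⟩
  rw [hmemP] at hd
  have h0 := h.val_zero
  have h1 := h.val_one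
  have key : ∀ {j' : Fin t} {q' : ℕ} {B' : Finset ℕ}, StrippedID n k j' q' B' →
      weight n B' ∈ P → N i₀ d ≤ N i₀ (weight n B') → (partner q' B').card ≤ k i₁ := by
    intro j' q' B' hB' hB'P hle
    by_contra hcon
    rw [hmemP] at hB'P
    obtain ⟨hu1, hu2, hu3⟩ := hB'P.1.add_two_pow h hB' (not_le.mp hcon)
    have := hdmax _ ((hmemP _).mpr ⟨hu1, Eq.trans hu2 hB'P.2⟩)
    simp only [hN] at this hle
    omega
  obtain ⟨j', q', B', hB', hc', heq⟩ := hd.1.exists_strippedID h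
  have hN' : ∀ i : Fin t, i.val < 2 → N i (weight n B') = N i d := by
    intro i hi
    have := congrArg card (congrFun heq i)
    rwa [thresholdSystem_of_lt n k _ hi, thresholdSystem_of_lt n k _ hi] at this
  have hB'P : weight n B' ∈ P := (hmemP _).mpr ⟨hc', by rw [hN' i₁ (by omega), hd.2]⟩
  have hH' := key hB' hB'P (hN' i₀ (by omega)).ge
  by_contra hcon
  by_cases hle : weight n B' ≤ weight n B
  · refine hcon (key hB ((hmemP _).mpr ⟨hc, rfl⟩) ?_)
    rw [← hN' i₀ (by omega)]
    exact card_le_card (threshold_subset (by omega))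
  · have hr := hB.room
    have hr' := hB'.room
    have hcard := card_partner_add hB.mem hB.subset
    have hcard' := card_partner_add hB'.mem hB'.subset
    have hsum := weight_partner_add (n := n) (by omega) hB.mem hB.subset
    have hsum' := weight_partner_add (n := n) (by omega) hB'.mem hB'.subset
    have hk := h.room i₁ j' hB'.two_le
    have hbk' := hB'.card_le
    have hs : q' + (k i₁ - (partner q' B').card) ≤ n := by omega
    have hK := fill_mem_ksubsets (partner_subset q' B') hs
    have hwK := weight_fill (partner_subset q' B') hs
    rw [Nat.add_sub_cancel' hH'] at hK
    have hth : threshold n (k i₁) (2 ^ n - weight n B) =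
        threshold n (k i₁) (2 ^ n - weight n B') := by
      refine eq_of_subset_of_card_le (threshold_subset (by omega)) ?_
      exact ((hmemP _).mp hB'P).2.le
    have hKth : fill n (k i₁ - (partner q' B').card) (partner q' B') ∈
        threshold n (k i₁) (2 ^ n - weight n B') := by
      refine mem_threshold.mpr ⟨mem_ksubsets.mp hK, ?_⟩
      have : 1 ≤ 2 ^ (k i₁ - (partner q' B').card) := Nat.one_le_two_pow
      omega
    rw [← hth] at hKth
    have hKw := (mem_threshold.mp hKth).2
    have hpow : 2 ^ (k i₁ - (partner q' B').card) ≤ 2 ^ (n - q') :=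
      Nat.pow_le_pow_right (by norm_num) (by omega)
    have hHn : partner q B ⊆ ground n :=
      subset_ground_of_subset_Icc (by omega) (partner_subset q B)
    have hpre := (inter_Icc_eq_iff (n := n) (by omega) (partner_subset q' B') hHn).mpr
      ⟨by omega, by omega⟩
    have hbig := weight_add_two_pow_le (c := (partner q B).card - (partner q' B').card) hHn hpre
      (by omega)
    have : 2 ^ (k i₁ - (partner q' B').card) < 2 ^ ((partner q B).card - (partner q' B').card) :=
      Nat.pow_lt_pow_right (by norm_num) (by omega)
    omega

theorem IsCIS.crossInt {n t : ℕ} {k : Fin t → ℕ} {F : Fin t → Finset (Finset ℕ)}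
    (hF : IsCIS n k F) {i j : Fin t} (hij : i ≠ j) : CrossInt (F i) (F j) := by
  rcases lt_or_gt_of_ne hij with h | h
  · exact hF.2.2 i j h
  · intro a ha b hb
    rw [inter_comm]
    exact hF.2.2 j i h b hb a ha

theorem mem_threshold_two_pow {n k : ℕ} (hn : 1 ≤ n) {G : Finset ℕ} :
    G ∈ threshold n k (2 ^ (n - 1)) ↔ (G ⊆ ground n ∧ G.card = k) ∧ 1 ∈ G := by
  rw [mem_threshold]
  exact and_congr_right fun hG =>
    ⟨one_mem_of_two_pow_le_weight hn hG.1, fun h => two_pow_le_weight n h⟩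

/-- A family of `f`-sets through `1` together with a cross intersecting family of `g`-sets,
`g < f`, is no larger than the two full stars at `1`. -/
theorem card_add_card_le_of_crossInt {n f g : ℕ} {A B : Finset (Finset ℕ)} (hgf : g < f)
    (hfg : f + g ≤ n) (hA : A ⊆ threshold n f (2 ^ (n - 1))) (hB : B ⊆ ksubsets n g)
    (hAB : CrossInt A B) :
    A.card + B.card ≤
      (threshold n f (2 ^ (n - 1))).card + (threshold n g (2 ^ (n - 1))).card := by
  have hn : 1 ≤ n := by omega
  have hgr : (ground n).card = n := by simp [ground]
  have h1n : 1 ∈ ground n := by simp [ground, hn]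
  have hcount : (B.filter fun b => 1 ∉ b).card * (n - g - 1).choose (f - 1) ≤
      (threshold n f (2 ^ (n - 1)) \ A).card * (n - f).choose g := by
    refine card_mul_le_card_mul Disjoint (fun b hb => ?_) fun a ha => ?_
    · obtain ⟨hbB, h1b⟩ := mem_filter.mp hb
      obtain ⟨hbn, hbg⟩ := mem_ksubsets.mp (hB hbB)
      have hc : ((ground n \ b).erase 1).card = n - g - 1 := by
        rw [card_erase_of_mem (mem_sdiff.mpr ⟨h1n, h1b⟩), card_sdiff_of_subset hbn, hgr, hbg]
      rw [← hc, ← card_powersetCard, ← card_image_of_injOn (f := insert 1)]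
      · refine card_le_card fun a ha => ?_
        obtain ⟨s, hs, rfl⟩ := mem_image.mp ha
        obtain ⟨hs, hsc⟩ := mem_powersetCard.mp hs
        have h1s : 1 ∉ s := fun h => notMem_erase 1 _ (hs h)
        have hsb : s ⊆ ground n \ b := hs.trans (erase_subset _ _)
        have hdisj : Disjoint b (insert 1 s) := by
          rw [disjoint_insert_right]
          exact ⟨h1b, (disjoint_sdiff (s := b)).mono_right hsb⟩
        refine (mem_bipartiteAbove Disjoint).mpr ⟨mem_sdiff.mpr ⟨?_, fun haA => ?_⟩, hdisj⟩
        · refine (mem_threshold_two_pow hn).mpr ⟨⟨insert_subset h1n (hsb.trans sdiff_subset), ?_⟩,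
            mem_insert_self _ _⟩
          rw [card_insert_of_notMem h1s, hsc]
          omega
        · exact (hAB _ haA b hbB).ne_empty (disjoint_iff_inter_eq_empty.mp hdisj.symm)
      · intro s hs s' hs' heq
        have h1 : ∀ u ∈ (powersetCard (f - 1) ((ground n \ b).erase 1) : Set (Finset ℕ)), 1 ∉ u :=
          fun u hu h => notMem_erase 1 _ ((mem_powersetCard.mp hu).1 h)
        rw [← erase_insert (h1 s hs), ← erase_insert (h1 s' hs')]
        exact congrArg (fun u => erase u 1) heq
    · obtain ⟨⟨han, haf⟩, -⟩ := mem_threshold.mp (mem_sdiff.mp ha).1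
      have hc : (ground n \ a).card = n - f := by rw [card_sdiff_of_subset han, hgr, haf]
      rw [← hc, ← card_powersetCard]
      refine card_le_card fun b hb => ?_
      obtain ⟨hb, hdisj⟩ := (mem_bipartiteBelow Disjoint).mp hb
      obtain ⟨hbn, hbg⟩ := mem_ksubsets.mp (hB (mem_filter.mp hb).1)
      exact mem_powersetCard.mpr ⟨subset_sdiff.mpr ⟨hbn, hdisj⟩, hbg⟩
  have hchoose : (n - f).choose g ≤ (n - g - 1).choose (f - 1) := by
    obtain ⟨r, rfl⟩ := Nat.exists_eq_add_of_le hfg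
    have h1 := Nat.choose_symm_add (a := g) (b := r)
    have h2 := Nat.choose_symm_add (a := f - 1) (b := r)
    rw [show f + g + r - f = g + r by omega, show f + g + r - g - 1 = f - 1 + r by omega, h1, h2]
    exact Nat.choose_le_choose r (by omega)
  have hpos : 0 < (n - g - 1).choose (f - 1) := Nat.choose_pos (by omega)
  have hle := Nat.le_of_mul_le_mul_right
    (hcount.trans (Nat.mul_le_mul_left _ hchoose)) hpos
  have hsplit := card_filter_add_card_filter_not (s := B) (fun b => 1 ∈ b)
  have hstar : (B.filter fun b => 1 ∈ b).card ≤ (threshold n g (2 ^ (n - 1))).card := by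
    refine card_le_card fun b hb => ?_
    rw [mem_filter] at hb
    exact (mem_threshold_two_pow hn).mpr ⟨mem_ksubsets.mp (hB hb.1), hb.2⟩
  rw [card_sdiff_of_subset hA] at hle
  have := card_le_card hA
  omega

/-- The standing assumptions on an extremal system of L-initial families with IDs `I i`. -/
structure InitialSystem (n : ℕ) {t : ℕ} (k : Fin t → ℕ) (F : Fin t → Finset (Finset ℕ))
    (I : Fin t → Finset ℕ) : Prop where
  extremal : Extremal n k F
  mem : ∀ i, I i ∈ ksubsets n (k i)
  eq : ∀ i, F i = threshold n (k i) (weight n (I i))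

theorem InitialSystem.mem_family {n t : ℕ} {k : Fin t → ℕ} {F : Fin t → Finset (Finset ℕ)}
    {I : Fin t → Finset ℕ} (hI : InitialSystem n k F I) (i : Fin t) : I i ∈ F i := by
  rw [hI.eq, mem_threshold]
  exact ⟨mem_ksubsets.mp (hI.mem i), le_rfl⟩

theorem InitialSystem.subset_threshold {n t : ℕ} {k : Fin t → ℕ} {i₀ i₁ : Fin t}
    (h : Regime n k i₀ i₁) {F : Fin t → Finset (Finset ℕ)} {I : Fin t → Finset ℕ}
    (hI : InitialSystem n k F I) {i j : Fin t} (hj : 2 ≤ j.val) (hij : i ≠ j) :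
    F i ⊆ threshold n (k i) (2 ^ n - weight n (I j)) := by
  intro K hK
  have hK' := mem_ksubsets.mp (hI.extremal.1.1 i hK)
  obtain ⟨hJ, hJc⟩ := mem_ksubsets.mp (hI.mem j)
  refine mem_threshold.mpr ⟨hK', ?_⟩
  have := two_pow_le_weight_add_of_forall_inter hJ hJc.le hK'.1
    (by rw [hK'.2]; exact h.room i j hj)
    fun G hG => hI.extremal.1.crossInt hij K hK G (by rw [hI.eq]; exact hG)
  omega

theorem InitialSystem.two_pow_le_weight {n t : ℕ} {k : Fin t → ℕ} {i₀ i₁ : Fin t}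
    (h : Regime n k i₀ i₁) {F : Fin t → Finset (Finset ℕ)} {I : Fin t → Finset ℕ}
    (hI : InitialSystem n k F I) {j : Fin t} (hj : 2 ≤ j.val) :
    2 ^ (n - 1) ≤ weight n (I j) := by
  by_contra hcon
  have h0 := h.val_zero
  have h1 := h.val_one
  have hn : 1 ≤ n := by have := h.card_lt i₀; omega
  have hpow := two_pow_eq hn
  have hj0 : j ≠ i₀ := by rintro rfl; omega
  have hj1 : i₁ ≠ j := by rintro rfl; omega
  have h10 : i₁ ≠ i₀ := by rintro rfl; omega
  have hT : ∀ i, thresholdSystem n k (2 ^ (n - 1)) i = threshold n (k i) (2 ^ (n - 1)) := by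
    intro i
    rw [thresholdSystem, show 2 ^ n - 2 ^ (n - 1) = 2 ^ (n - 1) by omega, ite_self]
  have hval : ValidThreshold n k (2 ^ (n - 1)) := by
    refine ⟨le_rfl, fun i _ => ⟨Icc 1 (k i), (mem_threshold_two_pow hn).mpr
      ⟨mem_ksubsets.mp (Icc_mem_ksubsets (h.card_lt i).le), ?_⟩⟩⟩
    have := h.two_le i
    exact mem_Icc.mpr ⟨le_rfl, by omega⟩
  have hsub : ∀ i, i ≠ j → F i ⊆ threshold n (k i) (2 ^ (n - 1)) := fun i hi =>
    (hI.subset_threshold h hj hi).trans (threshold_subset (by omega))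
  have hle := hI.extremal.2 _ (isCIS_thresholdSystem h hval)
  simp only [hT] at hle
  have hpair := card_add_card_le_of_crossInt
    ((h.anti i₁ j (Fin.le_def.mpr (by omega))).trans_lt h.lt)
    (h.room i₀ j hj) (hsub i₀ hj0.symm) (hI.extremal.1.1 j) (hI.extremal.1.crossInt hj0.symm)
  have hstrict : F i₁ ⊂ threshold n (k i₁) (2 ^ (n - 1)) := by
    refine (hsub i₁ hj1).ssubset_of_ne fun heq => ?_
    obtain ⟨hJ, hJc⟩ := mem_ksubsets.mp (hI.mem j)
    have h1J : 1 ∉ I j := fun h1 => hcon (_root_.two_pow_le_weight n h1)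
    have h1n : 1 ∈ ground n := by simp [ground, hn]
    have hc : ((ground n \ I j).erase 1).card = n - k j - 1 := by
      rw [card_erase_of_mem (mem_sdiff.mpr ⟨h1n, h1J⟩), card_sdiff_of_subset hJ, hJc]
      simp [ground]
    have hroom := h.room i₁ j hj
    have hk1 := h.two_le i₁
    obtain ⟨s, hs, hsc⟩ := exists_subset_card_eq (s := (ground n \ I j).erase 1)
      (n := k i₁ - 1) (by omega)
    have hs' := hs.trans (erase_subset _ _)
    have hmem : insert 1 s ∈ F i₁ := by
      rw [heq, mem_threshold_two_pow hn]
      refine ⟨⟨insert_subset h1n (hs'.trans sdiff_subset), ?_⟩, mem_insert_self _ _⟩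
      rw [card_insert_of_notMem fun h => notMem_erase 1 _ (hs h), hsc]
      omega
    obtain ⟨x, hx⟩ := hI.extremal.1.crossInt hj1 _ hmem _ (hI.mem_family j)
    obtain ⟨hx1, hx2⟩ := mem_inter.mp hx
    rcases mem_insert.mp hx1 with rfl | hxs
    · exact h1J hx2
    · exact (mem_sdiff.mp (hs' hxs)).2 hx2
  have hrest : ∑ i ∈ (univ.erase i₀).erase j, (F i).card <
      ∑ i ∈ (univ.erase i₀).erase j, (threshold n (k i) (2 ^ (n - 1))).card :=
    sum_lt_sum (fun i hi => card_le_card (hsub i (ne_of_mem_erase hi)))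
      ⟨i₁, by simp [h10, hj1], card_lt_card hstrict⟩
  have hsplit := fun f : Fin t → ℕ => add_sum_erase univ f (mem_univ i₀)
  have hsplit' := fun f : Fin t → ℕ => add_sum_erase (univ.erase i₀) f
    (mem_erase.mpr ⟨hj0, mem_univ j⟩)
  rw [← hsplit, ← hsplit', ← hsplit fun i => (F i).card, ← hsplit' fun i => (F i).card] at hle
  omega

theorem InitialSystem.exists_optimalThreshold {n t : ℕ} {k : Fin t → ℕ} {i₀ i₁ : Fin t}
    (h : Regime n k i₀ i₁) {F : Fin t → Finset (Finset ℕ)} {I : Fin t → Finset ℕ}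
    (hI : InitialSystem n k F I) : ∃ c, OptimalThreshold n k c ∧ F = thresholdSystem n k c := by
  obtain ⟨j, hj, hmin⟩ := exists_min_image (univ.filter fun i : Fin t => 2 ≤ i.val)
    (fun i => weight n (I i)) ⟨⟨2, h.three_le⟩, by simp⟩
  have hj2 := (mem_filter.mp hj).2
  have hF : ∀ i : Fin t, 2 ≤ i.val → F i ⊆ threshold n (k i) (weight n (I j)) := fun i hi => by
    rw [hI.eq]
    exact threshold_subset (hmin i (by simpa using hi))
  have hval : ValidThreshold n k (weight n (I j)) :=
    ⟨hI.two_pow_le_weight h hj2, fun i hi => ⟨I i, hF i hi (hI.mem_family i)⟩⟩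
  have heq := hI.extremal.eq_of_subset (isCIS_thresholdSystem h hval) fun i => by
    by_cases hi : i.val < 2
    · rw [thresholdSystem_of_lt n k _ hi]
      exact hI.subset_threshold h hj2 (by rintro rfl; omega)
    · rw [thresholdSystem_of_le n k _ (by omega)]
      exact hF i (by omega)
  exact ⟨_, ⟨hval, heq ▸ hI.extremal⟩, heq⟩

theorem ell_fill {n q s : ℕ} {A : Finset ℕ} (hA : A ⊆ Icc 1 q) (hs : q + s < n) :
    ell n (fill n s A) = s := by
  refine le_antisymm (Finset.sup_le fun x hx => ?_) ?_
  · obtain ⟨hxn, hx⟩ := mem_filter.mp hx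
    rw [mem_range] at hxn
    by_contra hcon
    rw [id, not_le] at hcon
    have hmem : n - s ∈ fill n s A := hx (mem_Icc.mpr ⟨by omega, Nat.sub_le _ _⟩)
    rcases mem_union.mp hmem with h | h
    · have := mem_Icc.mp (hA h)
      omega
    · exact (mem_Ioc.mp h).1.false
  · refine Finset.le_sup (f := id) (mem_filter.mpr ⟨mem_range.mpr (by omega), fun x hx => ?_⟩)
    rw [mem_Icc] at hx
    exact mem_union_right _ (mem_Ioc.mpr ⟨by omega, hx.2⟩)

theorem fill_sdiff_tailPart {n q s : ℕ} {A : Finset ℕ} (hA : A ⊆ Icc 1 q) (hs : q + s < n) :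
    fill n s A \ tailPart n (fill n s A) = A := by
  have htail : Icc (n - s + 1) n = Ioc (n - s) n := by
    ext x
    rw [mem_Icc, mem_Ioc, Nat.succ_le_iff]
  rw [tailPart, ell_fill hA hs, htail, fill,
    union_sdiff_cancel_right (disjoint_Ioc_of_subset_Icc (by omega) hA)]

theorem isParity_fill {n q s s' : ℕ} {A : Finset ℕ} (hA : A ⊆ Icc 1 q) (hs : q + s < n)
    (hs' : q + s' < n) : IsParity n (fill n s A) (fill n s' A) := by
  refine ⟨by rw [fill_sdiff_tailPart hA hs, fill_sdiff_tailPart hA hs'], ?_⟩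
  rw [ell_fill hA hs, ell_fill hA hs', (mem_ksubsets.mp (fill_mem_ksubsets hA hs.le)).2,
    (mem_ksubsets.mp (fill_mem_ksubsets hA hs'.le)).2]
  omega

theorem eq_fill_of_threshold_eq {n q s : ℕ} {A J : Finset ℕ} (hA : A ⊆ Icc 1 q) (hs : q + s ≤ n)
    (hJ : J ∈ ksubsets n (A.card + s))
    (h : threshold n (A.card + s) (weight n J) = threshold n (A.card + s) (weight n A)) :
    J = fill n s A := by
  rw [← threshold_fill hA hs] at h
  have hJ' := mem_ksubsets.mp hJ
  have hA' := mem_ksubsets.mp (fill_mem_ksubsets hA hs)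
  have h1 : J ∈ threshold n (A.card + s) (weight n (fill n s A)) :=
    h ▸ mem_threshold.mpr ⟨hJ', le_rfl⟩
  have h2 : fill n s A ∈ threshold n (A.card + s) (weight n J) :=
    h ▸ mem_threshold.mpr ⟨hA', le_rfl⟩
  exact weight_injOn hJ'.1 hA'.1
    ((mem_threshold.mp h2).2.antisymm (mem_threshold.mp h1).2)

theorem pairMaximal_fill {n q s s' : ℕ} {A B : Finset ℕ} (hA : A ⊆ Icc 1 q) (hB : B ⊆ Icc 1 q)
    (hs : q + s ≤ n) (hs' : q + s' ≤ n) (hAB : weight n A + weight n B = 2 ^ n)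
    (hn : A.card + s + (B.card + s') ≤ n) : PairMaximal n (fill n s A) (fill n s' B) := by
  obtain ⟨hA', hAc⟩ := mem_ksubsets.mp (fill_mem_ksubsets hA hs)
  obtain ⟨hB', hBc⟩ := mem_ksubsets.mp (fill_mem_ksubsets hB hs')
  have hAn := subset_ground_of_subset_Icc (n := n) (by omega) hA
  have hBn := subset_ground_of_subset_Icc (n := n) (by omega) hB
  rw [PairMaximal, hAc, hBc, Lset_eq_threshold hA', Lset_eq_threshold hB', threshold_fill hA hs,
    threshold_fill hB hs']
  refine ⟨filter_subset _ _, filter_subset _ _, crossInt_threshold hAB.ge,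
    fun F G hF hFk hG hGk hFG => ⟨hF.antisymm fun K hK => ?_, hG.antisymm fun K hK => ?_⟩⟩
  · have hK' := mem_ksubsets.mp (hFk hK)
    refine mem_threshold.mpr ⟨hK', ?_⟩
    have := two_pow_le_weight_add_of_forall_inter hBn (Nat.le_add_right _ s') hK'.1
      (by rw [hK'.2]; exact hn) fun L hL => hFG K hK L (hG hL)
    omega
  · have hK' := mem_ksubsets.mp (hGk hK)
    refine mem_threshold.mpr ⟨hK', ?_⟩
    have := two_pow_le_weight_add_of_forall_inter hAn (Nat.le_add_right _ s) hK'.1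
      (by rw [hK'.2, add_comm]; exact hn)
      fun L hL => by rw [inter_comm]; exact hFG L (hF hL) K hK
    omega

/-- A `k`-set which is preceded by `{1, n - k + 2, …, n}` and meets `[m]` lies in `ℛ₂`. -/
theorem mem_R2fam {n k m : ℕ} {J : Finset ℕ} (hJ : J ∈ ksubsets n k) (hk : 2 ≤ k)
    (hm : 1 ≤ m) (hmn : m + k ≤ n)
    (hle : weight n J ≤ weight n (insert 1 (Icc (n - k + 2) n)))
    (hmeet : (J ∩ Icc 1 m).Nonempty) : J ∈ R2fam n k m := by
  obtain ⟨hJn, hJk⟩ := mem_ksubsets.mp hJ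
  have hIcc : Icc (n - k + 2) n = Ioc (n - (k - 1)) n := by
    ext x
    rw [mem_Icc, mem_Ioc]
    omega
  have hground : ∀ a, 1 ≤ a → a ≤ n → insert a (Icc (n - k + 2) n) ⊆ ground n := fun a h1 h2 =>
    insert_subset (mem_Icc.mpr ⟨h1, h2⟩) (Icc_subset_Icc_left (by omega))
  refine mem_filter.mpr ⟨hJ, (lex_iff_weight_le (hground 1 le_rfl (by omega)) hJn).mpr hle,
    (lex_iff_weight_le hJn (hground m hm (by omega))).mpr ?_⟩
  obtain ⟨x, hx⟩ := hmeet
  obtain ⟨hxJ, hxm⟩ := mem_inter.mp hx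
  obtain ⟨hx1, hxm⟩ := mem_Icc.mp hxm
  have h1 := weight_Ioc_add_one (n := n) (p := n - (k - 1)) (Nat.sub_le _ _)
  have h2 : weight n (insert m (Icc (n - k + 2) n)) =
      2 ^ (n - m) + weight n (Ioc (n - (k - 1)) n) := by
    rw [hIcc, weight, sum_insert (by rw [mem_Ioc]; omega), weight]
  have h3 := weight_erase_add n hxJ
  have h4 := two_pow_card_le_weight_add_one (n := n) (S := J.erase x)
    ((erase_subset _ _).trans hJn)
  rw [card_erase_of_mem hxJ, hJk] at h4
  have h5 : 2 ^ (n - m) ≤ 2 ^ (n - x) := Nat.pow_le_pow_right (by norm_num) (by omega)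
  rw [Nat.sub_sub_self (by omega)] at h1
  omega

theorem InitialSystem.mem_F23_and_isParity {n t : ℕ} {k : Fin t → ℕ} {i₀ i₁ : Fin t}
    (h : Regime n k i₀ i₁) {F : Fin t → Finset (Finset ℕ)} {I : Fin t → Finset ℕ}
    (hI : InitialSystem n k F I) {l m : Fin t} (hl : l.val = 2) (hm : 2 ≤ m.val) :
    I i₁ ∈ F23 n (k i₁) (k l) (k m) ∧ IsParity n (I i₁) (I i₀) := by
  have h0 := h.val_zero
  have h1 := h.val_one
  have hn : 1 ≤ n := by have := h.card_lt i₀; omega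
  obtain ⟨c, hc, hFc⟩ := hI.exists_optimalThreshold h
  obtain ⟨j, q, B, hB, hc', heq⟩ := hc.exists_strippedID h
  have hF : F = thresholdSystem n k (weight n B) := hFc.trans heq.symm
  have hH := hc'.card_partner_le h hB
  have hHq := partner_subset q B
  have hr := hB.room
  have hbj := hB.card_le
  have hcard := card_partner_add hB.mem hB.subset
  have hsum := weight_partner_add (n := n) (by omega) hB.mem hB.subset
  have hfill : ∀ i : Fin t, i.val < 2 → (partner q B).card ≤ k i →
      q + (k i - (partner q B).card) < n ∧ I i = fill n (k i - (partner q B).card) (partner q B) := by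
    intro i hi hle
    have hroom := h.room i j hB.two_le
    have hs : q + (k i - (partner q B).card) < n := by omega
    refine ⟨hs, eq_fill_of_threshold_eq hHq hs.le ?_ ?_⟩
    · rw [Nat.add_sub_cancel' hle]
      exact hI.mem i
    · rw [Nat.add_sub_cancel' hle, ← hI.eq, hF, thresholdSystem_of_lt n k _ hi]
      congr 1
      omega
  obtain ⟨hs0, hI0⟩ := hfill i₀ (by omega) (hH.trans h.lt.le)
  obtain ⟨hs1, hI1⟩ := hfill i₁ (by omega) hH
  have hlj : k j ≤ k l := h.anti l j (Fin.le_def.mpr (by have := hB.two_le; omega))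
  have hroom0 := h.room i₀ l hl.ge
  have hroom1 := h.room i₁ l hl.ge
  have hlt := h.lt
  have hsl : q + (k l - B.card) ≤ n := by omega
  refine ⟨mem_filter.mpr ⟨?_, fill n (k l - B.card) B, ?_, ?_⟩, ?_⟩
  · have hk1 := h.two_le i₁
    have hkm := h.two_le m
    have hroom := h.room i₁ m hm
    refine mem_R2fam (hI.mem i₁) hk1 (by omega) (by omega) ?_ ?_
    · have hmem : insert 1 (Icc (n - k i₁ + 2) n) ∈ F i₁ := by
        rw [hF, thresholdSystem_of_lt n k _ (by omega)]
        refine threshold_subset (c := 2 ^ (n - 1)) ?_ ((mem_threshold_two_pow hn).mpr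
          ⟨⟨insert_subset (mem_Icc.mpr ⟨le_rfl, hn⟩) (Icc_subset_Icc_left (by omega)), ?_⟩,
            mem_insert_self _ _⟩)
        · have := two_pow_eq hn
          have := hc'.1.1
          omega
        · rw [card_insert_of_notMem (by rw [mem_Icc]; omega), Nat.card_Icc]
          omega
      rw [hI.eq] at hmem
      exact (mem_threshold.mp hmem).2
    · refine hI.extremal.1.crossInt (j := m) (by rintro rfl; omega) _ (hI.mem_family i₁) _ ?_
      obtain ⟨hJ, hJm⟩ := mem_ksubsets.mp (hI.mem m)
      rw [hI.eq]
      refine mem_threshold.mpr ⟨mem_ksubsets.mp (Icc_mem_ksubsets (h.card_lt m).le), ?_⟩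
      rw [← hJm]
      exact weight_le_weight_Icc_card hJ
  · have := fill_mem_ksubsets hB.subset hsl
    rwa [Nat.add_sub_cancel' (by omega)] at this
  · rw [hI1]
    refine pairMaximal_fill hHq hB.subset hs1.le hsl hsum ?_
    omega
  · rw [hI1, hI0]
    exact isParity_fill hHq hs1 hs0

/-- in an extremal L-initial system, `I₂ ∈ ℱ₂,₃` and `I₁` is the
`k₁`-parity of `I₂`. -/
theorem extremal_ID_parity (n t : ℕ) (k : Fin t → ℕ)
    (F : Fin t → Finset (Finset ℕ)) (I : Fin t → Finset ℕ)
    (ht : 3 ≤ t)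
    (hanti : ∀ i j : Fin t, i ≤ j → k j ≤ k i)
    (h12 : k ⟨1, by omega⟩ < k ⟨0, by omega⟩)
    (hkt : 2 ≤ k ⟨t - 1, by omega⟩)
    (hn1 : k ⟨0, by omega⟩ + k ⟨2, by omega⟩ ≤ n)
    (hn2 : n < k ⟨0, by omega⟩ + k ⟨1, by omega⟩)
    (hext : Extremal n k F)
    (hID : ∀ i, I i ∈ ksubsets n (k i) ∧ F i = Lset n (I i) (k i)) :
    I ⟨1, by omega⟩ ∈ F23 n (k ⟨1, by omega⟩) (k ⟨2, by omega⟩) (k ⟨t - 1, by omega⟩) ∧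
    IsParity n (I ⟨1, by omega⟩) (I ⟨0, by omega⟩) := by
  have h : Regime n k ⟨0, by omega⟩ ⟨1, by omega⟩ := by
    refine ⟨rfl, rfl, ht, hanti, h12, fun i => ?_, fun i j hj => ?_, hn2⟩
    · exact hkt.trans (hanti i _ (Fin.le_def.mpr (Nat.le_sub_one_of_lt i.isLt)))
    · exact (add_le_add (hanti _ i (Fin.le_def.mpr (Nat.zero_le _)))
        (hanti _ j (Fin.le_def.mpr hj))).trans hn1
  have hI : InitialSystem n k F I := by
    refine ⟨hext, fun i => (hID i).1, fun i => ?_⟩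
    rw [(hID i).2, Lset_eq_threshold (mem_ksubsets.mp (hID i).1).1]
  exact hI.mem_F23_and_isParity h rfl (Nat.le_sub_one_of_lt ht)
end
end

section
/- Let t ≥ 3, k1 > k2 ≥ ... ≥ kt ≥ 2 and k1 + k3 ≤ n < k1 + k2. Let A ∈ C([n],k2) with ℓ(A) = p ≥ 1, write A = {x1, ..., x_{k2−p}} ∪ {n−p+1, ..., n} with x1 < ... < x_{k2−p} < n−p+1, and set A′ = {x1, ..., x_{k2−p}, x_{k2−p}+1} ∪ {n−p+2, ..., n} (where {n−p+2, ..., n} is empty if p = 1). If A ∈ ℱ_{2,3} and {1, n−k2+2, ..., n} ⪵ A, then A′ ∈ ℱ_{2,3}. -/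
open Finset

attribute [local instance] Classical.propDecidable

noncomputable section

theorem lex_iff_exists (A B : Finset ℕ) :
    lex A B ↔ B ⊆ A ∨ ∃ y ∈ A \ B, ∀ z ∈ B \ A, y < z := by
  unfold lex
  refine or_congr Iff.rfl ⟨fun h => ?_, ?_⟩
  · obtain ⟨y, hy⟩ := WithTop.ne_top_iff_exists.mp (ne_top_of_lt h)
    refine ⟨y, Finset.mem_of_min hy.symm, fun z hz => ?_⟩
    have := h.trans_le (Finset.min_le hz)
    rw [← hy] at this
    exact WithTop.coe_lt_coe.mp this
  · rintro ⟨y, hy, h⟩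
    refine (Finset.min_le hy).trans_lt ?_
    rcases (B \ A).eq_empty_or_nonempty with he | hne
    · rw [he, Finset.min_empty]
      exact WithTop.coe_lt_top y
    · obtain ⟨z, hz⟩ := Finset.min_of_nonempty hne
      rw [hz]
      exact WithTop.coe_lt_coe.mpr (h z (Finset.mem_of_min hz))

theorem eq_of_lex_of_lex {A B : Finset ℕ} (hcard : A.card = B.card)
    (hAB : lex A B) (hBA : lex B A) : A = B := by
  rcases hAB with h | h
  · exact (Finset.eq_of_subset_of_card_le h hcard.le).symm
  · rcases hBA with h' | h'
    · exact Finset.eq_of_subset_of_card_le h' hcard.ge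
    · exact absurd h' h.asymm

/-- `F` contains `D`, or `F` precedes `D` because of an element smaller than `q`. -/
def Precedes (D : Finset ℕ) (q : ℕ) (F : Finset ℕ) : Prop :=
  D ⊆ F ∨ ∃ y ∈ F, y ∉ D ∧ y < q ∧ ∀ z ∈ D, z < y → z ∈ F

/-- A set `D ∪ {a, …, n}` is the last set of its size that contains `D`, so preceding it
amounts to preceding `D`. -/
theorem lex_union_Icc_iff {n q a : ℕ} {D F : Finset ℕ} (hD : ∀ z ∈ D, z ≤ q)
    (hqa : q < a) (hF : F ⊆ Finset.Icc 1 n) (hcard : F.card = (D ∪ Finset.Icc a n).card) :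
    lex F (D ∪ Finset.Icc a n) ↔ Precedes D q F := by
  rw [lex_iff_exists]
  constructor
  · rintro (h | ⟨y, hy, h⟩)
    · exact Or.inl (Finset.union_subset_left h)
    · by_cases hDF : D ⊆ F
      · exact Or.inl hDF
      · obtain ⟨w, hwD, hwF⟩ := Finset.not_subset.mp hDF
        have hyw := h w (by simp [hwD, hwF])
        simp only [Finset.mem_sdiff, Finset.mem_union, not_or] at hy
        refine Or.inr ⟨y, hy.1, hy.2.1, hyw.trans_le (hD w hwD), fun z hz hzy => ?_⟩
        by_contra hzF
        exact absurd (h z (by simp [hz, hzF])) hzy.asymm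
  · rintro (h | ⟨y, hyF, hyD, hyq, h⟩)
    · by_cases hsub : F ⊆ D ∪ Finset.Icc a n
      · exact Or.inl (Finset.eq_of_subset_of_card_le hsub hcard.ge).ge
      · obtain ⟨y, hyF, hyA⟩ := Finset.not_subset.mp hsub
        refine Or.inr ⟨y, by simp [hyF, hyA], fun z hz => ?_⟩
        have hyn := (Finset.mem_Icc.mp (hF hyF)).2
        simp only [Finset.mem_sdiff, Finset.mem_union, Finset.mem_Icc] at hz hyA
        have : z ∉ D := fun hzD => hz.2 (h hzD)
        have : a ≤ z := by tauto
        have : ¬ a ≤ y := by tauto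
        omega
    · refine Or.inr ⟨y, ?_, fun z hz => ?_⟩
      · simp only [Finset.mem_sdiff, Finset.mem_union, Finset.mem_Icc]
        exact ⟨hyF, fun hy => hy.elim hyD fun hy => by omega⟩
      · simp only [Finset.mem_sdiff, Finset.mem_union, Finset.mem_Icc] at hz
        rcases hz.1 with hzD | hz'
        · have hzy : ¬ z < y := fun hzy => hz.2 (h z hzD hzy)
          have hne : z ≠ y := fun e => hyD (e ▸ hzD)
          omega
        · omega

theorem exists_superset_disjoint {n f g : ℕ} {F X : Finset ℕ} (hF : F ∈ ksubsets n f)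
    (hfg : f + g ≤ n) (hX : X ⊆ Finset.Icc 1 n) (hXF : Disjoint X F) (hXg : X.card ≤ g) :
    ∃ G ∈ ksubsets n g, X ⊆ G ∧ Disjoint G F := by
  simp only [ksubsets, ground, Finset.mem_powersetCard] at hF ⊢
  have hsub : X ⊆ Finset.Icc 1 n \ F := Finset.subset_sdiff.mpr ⟨hX, hXF⟩
  have hcard : g ≤ (Finset.Icc 1 n \ F).card := by
    rw [Finset.card_sdiff_of_subset hF.1, Nat.card_Icc]
    omega
  obtain ⟨G, hXG, hG, hGg⟩ := Finset.exists_subsuperset_card_eq hsub hXg hcard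
  exact ⟨G, ⟨hG.trans Finset.sdiff_subset, hGg⟩, hXG, (Finset.subset_sdiff.mp hG).2⟩

theorem inter_nonempty_of_precedes {q : ℕ} {D P F G : Finset ℕ}
    (hinter : D ∩ P = {q}) (hunion : D ∪ P = Finset.Icc 1 q)
    (hF1 : ∀ y ∈ F, 1 ≤ y) (hG1 : ∀ y ∈ G, 1 ≤ y)
    (hF : Precedes D q F) (hG : Precedes P q G) : (F ∩ G).Nonempty := by
  have hq : q ∈ D ∩ P := by simp [hinter]
  have hmem : ∀ y, 1 ≤ y → y ≤ q → y ∈ D ∨ y ∈ P := fun y h1 h2 =>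
    Finset.mem_union.mp (hunion ▸ Finset.mem_Icc.mpr ⟨h1, h2⟩)
  rw [Finset.mem_inter] at hq
  rcases hF with hF | ⟨y, hyF, hyD, hyq, hy⟩ <;> rcases hG with hG | ⟨w, hwG, hwP, hwq, hw⟩
  · exact ⟨q, Finset.mem_inter.mpr ⟨hF hq.1, hG hq.2⟩⟩
  · have hwD := (hmem w (hG1 w hwG) hwq.le).resolve_right hwP
    exact ⟨w, Finset.mem_inter.mpr ⟨hF hwD, hwG⟩⟩
  · have hyP := (hmem y (hF1 y hyF) hyq.le).resolve_left hyD
    exact ⟨y, Finset.mem_inter.mpr ⟨hyF, hG hyP⟩⟩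
  · have hwD := (hmem w (hG1 w hwG) hwq.le).resolve_right hwP
    have hyP := (hmem y (hF1 y hyF) hyq.le).resolve_left hyD
    rcases lt_trichotomy y w with h | h | h
    · exact ⟨y, Finset.mem_inter.mpr ⟨hyF, hw y hyP h⟩⟩
    · exact absurd (h ▸ hwD) hyD
    · exact ⟨w, Finset.mem_inter.mpr ⟨hy w hwD h, hwG⟩⟩

/-- A set that does not precede `D` is disjoint from some set that precedes the partner of `D`. -/
theorem exists_disjoint_of_not_precedes {n f g q : ℕ} {D P F : Finset ℕ}
    (hinter : D ∩ P = {q}) (hunion : D ∪ P = Finset.Icc 1 q) (hqn : q ≤ n)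
    (hfg : f + g ≤ n) (hPg : P.card ≤ g) (hF : F ∈ ksubsets n f) (hFD : ¬ Precedes D q F) :
    ∃ G ∈ ksubsets n g, Precedes P q G ∧ Disjoint G F := by
  have hq : q ∈ D ∩ P := by simp [hinter]
  rw [Finset.mem_inter] at hq
  have hPle : ∀ y ∈ P, 1 ≤ y ∧ y ≤ q := fun y hy =>
    Finset.mem_Icc.mp (hunion ▸ Finset.mem_union_right D hy)
  have hDle : ∀ y ∈ D, 1 ≤ y ∧ y ≤ q := fun y hy =>
    Finset.mem_Icc.mp (hunion ▸ Finset.mem_union_left P hy)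
  have hboth : ∀ y, y ∈ D → y ∈ P → y = q := fun y h1 h2 =>
    Finset.mem_singleton.mp (hinter ▸ Finset.mem_inter.mpr ⟨h1, h2⟩)
  simp only [Precedes, not_or] at hFD
  obtain ⟨hsub, hno⟩ := hFD
  have hne : (D \ F).Nonempty := Finset.sdiff_nonempty.mpr hsub
  obtain ⟨z, hz, hzmin⟩ : ∃ z ∈ D \ F, ∀ w ∈ D \ F, z ≤ w :=
    ⟨_, Finset.min'_mem _ hne, fun w hw => Finset.min'_le _ w hw⟩
  rw [Finset.mem_sdiff] at hz
  have hzq := hDle z hz.1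
  have hbelow : ∀ y ∈ F, y < z → y ∈ D := by
    intro y hy hyz
    by_contra hyD
    refine hno ⟨y, hy, hyD, by omega, fun w hw hwy => ?_⟩
    by_contra hwF
    have := hzmin w (Finset.mem_sdiff.mpr ⟨hw, hwF⟩)
    omega
  have hXsub : insert z (P.filter (· < z)) ⊆ Finset.Icc 1 n := by
    intro y hy
    rw [Finset.mem_insert, Finset.mem_filter] at hy
    rw [Finset.mem_Icc]
    rcases hy with rfl | hy
    · omega
    · have := hPle y hy.1
      omega
  have hXdisj : Disjoint (insert z (P.filter (· < z))) F := by
    rw [Finset.disjoint_left]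
    intro y hy hyF
    rw [Finset.mem_insert, Finset.mem_filter] at hy
    rcases hy with rfl | hy
    · exact hz.2 hyF
    · have := hboth y (hbelow y hyF hy.2) hy.1
      omega
  have hXcard : (insert z (P.filter (· < z))).card ≤ g := by
    refine le_trans ?_ hPg
    refine (Finset.card_insert_le _ _).trans (Finset.card_lt_card ?_)
    exact Finset.filter_ssubset.mpr ⟨q, hq.2, by omega⟩
  obtain ⟨G, hG, hXG, hGF⟩ := exists_superset_disjoint hF hfg hXsub hXdisj hXcard
  refine ⟨G, hG, ?_, hGF⟩
  have hzG : z ∈ G := hXG (Finset.mem_insert_self _ _)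
  have hPG : ∀ w ∈ P, w < z → w ∈ G := fun w hw hwz =>
    hXG (Finset.mem_insert_of_mem (Finset.mem_filter.mpr ⟨hw, hwz⟩))
  by_cases h : z = q
  · subst h
    refine Or.inl fun w hw => ?_
    rcases (hPle w hw).2.lt_or_eq with h | rfl
    · exact hPG w hw h
    · exact hzG
  · exact Or.inr ⟨z, hzG, fun hzP => h (hboth z hz.1 hzP), by omega, hPG⟩

theorem mem_Lset_iff_precedes {n q a f : ℕ} {D F : Finset ℕ} (hD : ∀ z ∈ D, z ≤ q)
    (hqa : q < a) (hcard : (D ∪ Finset.Icc a n).card = f) :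
    F ∈ Lset n (D ∪ Finset.Icc a n) f ↔ F ∈ ksubsets n f ∧ Precedes D q F := by
  rw [Lset, Finset.mem_filter]
  refine and_congr_right fun hF => ?_
  rw [ksubsets, ground, Finset.mem_powersetCard] at hF
  exact lex_union_Icc_iff hD hqa hF.1 (hF.2.trans hcard.symm)

/-- Partners `D` and `P`, padded with tails to sizes `f` and `g`, form a maximal pair. -/
theorem pairMaximal_of_partners {n f g q a b : ℕ} {D P : Finset ℕ}
    (hinter : D ∩ P = {q}) (hunion : D ∪ P = Finset.Icc 1 q) (hqn : q ≤ n) (hfg : f + g ≤ n)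
    (hqa : q < a) (hqb : q < b) (hf : (D ∪ Finset.Icc a n).card = f)
    (hg : (P ∪ Finset.Icc b n).card = g) :
    PairMaximal n (D ∪ Finset.Icc a n) (P ∪ Finset.Icc b n) := by
  have hPle : ∀ y ∈ P, y ≤ q := fun y hy =>
    (Finset.mem_Icc.mp (hunion ▸ Finset.mem_union_right D hy)).2
  have hDle : ∀ y ∈ D, y ≤ q := fun y hy =>
    (Finset.mem_Icc.mp (hunion ▸ Finset.mem_union_left P hy)).2
  have hDf : D.card ≤ f := hf ▸ Finset.card_le_card Finset.subset_union_left
  have hPg : P.card ≤ g := hg ▸ Finset.card_le_card Finset.subset_union_left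
  have hA := fun F => mem_Lset_iff_precedes (F := F) hDle hqa hf
  have hB := fun G => mem_Lset_iff_precedes (F := G) hPle hqb hg
  have hpos : ∀ {k : ℕ} {F : Finset ℕ}, F ∈ ksubsets n k → ∀ y ∈ F, 1 ≤ y := by
    intro k F hF y hy
    rw [ksubsets, ground, Finset.mem_powersetCard] at hF
    exact (Finset.mem_Icc.mp (hF.1 hy)).1
  rw [PairMaximal, hf, hg]
  refine ⟨Finset.filter_subset _ _, Finset.filter_subset _ _, ?_, ?_⟩
  · intro F hF G hG
    rw [hA] at hF
    rw [hB] at hG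
    exact inter_nonempty_of_precedes hinter hunion (hpos hF.1) (hpos hG.1) hF.2 hG.2
  · intro F' G' hFF' hF' hGG' hG' hcross
    constructor
    · refine hFF'.antisymm fun F hF => (hA F).mpr ⟨hF' hF, ?_⟩
      by_contra hno
      obtain ⟨G, hG, hPG, hGF⟩ :=
        exists_disjoint_of_not_precedes hinter hunion hqn hfg hPg (hF' hF) hno
      exact (hcross F hF G (hGG' ((hB G).mpr ⟨hG, hPG⟩))).ne_empty
        (Finset.disjoint_iff_inter_eq_empty.mp hGF.symm)
    · refine hGG'.antisymm fun G hG => (hB G).mpr ⟨hG' hG, ?_⟩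
      by_contra hno
      obtain ⟨F, hF, hDF, hFG⟩ :=
        exists_disjoint_of_not_precedes (Finset.inter_comm D P ▸ hinter)
          (Finset.union_comm D P ▸ hunion) hqn (Nat.add_comm f g ▸ hfg) hDf (hG' hG) hno
      exact (hcross F (hFF' ((hA F).mpr ⟨hF, hDF⟩)) G hG).ne_empty
        (Finset.disjoint_iff_inter_eq_empty.mp hFG)

/-- If `D`, padded with a tail, has a maximal partner of size `g`, then the partner
of `D` inside `{1, …, q}` has at most `g` elements. -/
theorem lt_of_pairMaximal {n f g q a : ℕ} {D B : Finset ℕ} (hD : D ⊆ Finset.Icc 1 q)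
    (hqD : q ∈ D) (hqa : q < a) (hfg : f + g ≤ n) (hf : (D ∪ Finset.Icc a n).card = f)
    (hroom : q + 1 + (f - D.card) ≤ n) (hB : B ∈ ksubsets n g)
    (hmax : PairMaximal n (D ∪ Finset.Icc a n) B) : q < D.card + g := by
  by_contra! hlarge
  have hDle : ∀ y ∈ D, 1 ≤ y ∧ y ≤ q := fun y hy => Finset.mem_Icc.mp (hD hy)
  have hDf : D.card ≤ f := hf ▸ Finset.card_le_card Finset.subset_union_left
  have hDpos : 0 < D.card := Finset.card_pos.mpr ⟨q, hqD⟩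
  have hBg : B.card = g := by
    rw [ksubsets, Finset.mem_powersetCard] at hB
    exact hB.2
  rw [PairMaximal, hf, hBg] at hmax
  obtain ⟨hsubF, hsubG, hcross, hbest⟩ := hmax
  have hA := fun F => mem_Lset_iff_precedes (F := F) (fun y hy => (hDle y hy).2) hqa hf
  set E := D.erase q ∪ Finset.Icc (q + 1) (q + 1 + (f - D.card)) with hE
  have hEcard : E.card = f := by
    rw [hE, Finset.card_union_of_disjoint, Finset.card_erase_of_mem hqD, Nat.card_Icc]
    · omega
    · rw [Finset.disjoint_left]
      intro y hy hy'
      have := hDle y (Finset.mem_of_mem_erase hy)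
      have := Finset.mem_Icc.mp hy'
      omega
  have hEmem : E ∈ ksubsets n f := by
    rw [ksubsets, ground, Finset.mem_powersetCard]
    refine ⟨fun y hy => ?_, hEcard⟩
    rw [hE, Finset.mem_union, Finset.mem_Icc] at hy
    rw [Finset.mem_Icc]
    rcases hy with hy | hy
    · have := hDle y (Finset.mem_of_mem_erase hy)
      omega
    · omega
  have hEnot : E ∉ Lset n (D ∪ Finset.Icc a n) f := by
    rw [hA]
    rintro ⟨-, h | ⟨y, hyE, hyD, hyq, -⟩⟩
    · have := h hqD
      simp [hE] at this
    · rw [hE, Finset.mem_union, Finset.mem_Icc] at hyE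
      rcases hyE with hy | hy
      · exact hyD (Finset.mem_of_mem_erase hy)
      · omega
  have hcross' : CrossInt (insert E (Lset n (D ∪ Finset.Icc a n) f)) (Lset n B g) := by
    intro F hF G hG
    rcases Finset.mem_insert.mp hF with rfl | hF
    swap
    · exact hcross F hF G hG
    by_contra hempty
    have hEG : ∀ y ∈ D.erase q, y ∉ G := fun y hy hyG =>
      hempty ⟨y, Finset.mem_inter.mpr ⟨Finset.mem_union_left _ hy, hyG⟩⟩
    have hGmem := hsubG hG
    suffices ∃ F ∈ ksubsets n f, Precedes D q F ∧ Disjoint F G by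
      obtain ⟨F, hF, hDF, hFG⟩ := this
      exact (hcross F ((hA F).mpr ⟨hF, hDF⟩) G hG).ne_empty
        (Finset.disjoint_iff_inter_eq_empty.mp hFG)
    by_cases hqG : q ∈ G
    · have hGcard : G.card = g := by
        rw [ksubsets, Finset.mem_powersetCard] at hGmem
        exact hGmem.2
      obtain ⟨y, hy, hyG⟩ : ∃ y ∈ Finset.Icc 1 q \ D, y ∉ G.erase q := by
        refine Finset.exists_mem_notMem_of_card_lt_card ?_
        rw [Finset.card_erase_of_mem hqG, Finset.card_sdiff_of_subset hD, Nat.card_Icc]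
        have : 0 < G.card := Finset.card_pos.mpr ⟨q, hqG⟩
        omega
      rw [Finset.mem_sdiff, Finset.mem_Icc] at hy
      have hyq : y ≠ q := fun h => hy.2 (h ▸ hqD)
      obtain ⟨F, hF, hXF, hFG⟩ := exists_superset_disjoint (g := f)
        (X := insert y (D.erase q)) hGmem (by omega)
        (by
          intro w hw
          rw [Finset.mem_Icc]
          rcases Finset.mem_insert.mp hw with rfl | hw
          · omega
          · have := hDle w (Finset.mem_of_mem_erase hw)
            omega)
        (by
          rw [Finset.disjoint_insert_left, Finset.disjoint_left]
          exact ⟨fun h => hyG (Finset.mem_erase.mpr ⟨hyq, h⟩), hEG⟩)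
        (by
          refine (Finset.card_insert_le _ _).trans ?_
          rw [Finset.card_erase_of_mem hqD]
          omega)
      refine ⟨F, hF, Or.inr ⟨y, hXF (Finset.mem_insert_self _ _), hy.2, by omega, ?_⟩, hFG⟩
      intro z hz hzy
      exact hXF (Finset.mem_insert_of_mem (Finset.mem_erase.mpr ⟨by omega, hz⟩))
    · obtain ⟨F, hF, hXF, hFG⟩ := exists_superset_disjoint (g := f) (X := D) hGmem (by omega)
        (hD.trans (Finset.Icc_subset_Icc_right (by omega)))
        (by
          rw [Finset.disjoint_left]
          intro y hy hyG
          by_cases h : y = q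
          · exact hqG (h ▸ hyG)
          · exact hEG y (Finset.mem_erase.mpr ⟨h, hy⟩) hyG) hDf
      exact ⟨F, hF, Or.inl hXF, hFG⟩
  have := (hbest _ _ (Finset.subset_insert _ _)
    (Finset.insert_subset hEmem hsubF) (Finset.Subset.refl _) hsubG hcross').1
  exact hEnot (this ▸ Finset.mem_insert_self _ _)

theorem ell_le_and_tailPart_subset (n : ℕ) (F : Finset ℕ) :
    ell n F ≤ n ∧ tailPart n F ⊆ F := by
  obtain ⟨y, hy, h⟩ := Finset.exists_mem_eq_sup
    ((Finset.range (n + 1)).filter fun x => Finset.Icc (n - x + 1) n ⊆ F)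
    ⟨0, by simp⟩ id
  have hell : ell n F = y := h
  rw [Finset.mem_filter, Finset.mem_range] at hy
  rw [tailPart, hell]
  exact ⟨by omega, hy.2⟩

theorem sub_ell_notMem {n : ℕ} {F : Finset ℕ} (h : ell n F < n) : n - ell n F ∉ F := by
  intro hmem
  have : ell n F + 1 ≤ ell n F := by
    refine Finset.le_sup (f := id)
      (s := (Finset.range (n + 1)).filter fun x => Finset.Icc (n - x + 1) n ⊆ F) ?_
    rw [Finset.mem_filter, Finset.mem_range]
    refine ⟨by omega, fun y hy => ?_⟩
    rw [Finset.mem_Icc] at hy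
    by_cases hy' : y = n - ell n F
    · exact hy' ▸ hmem
    · exact (ell_le_and_tailPart_subset n F).2 (Finset.mem_Icc.mpr ⟨by omega, hy.2⟩)
  omega

theorem lex_insert_Icc_iff {n f e : ℕ} {F : Finset ℕ} (hf : 1 ≤ f) (hfe : e + f ≤ n + 1)
    (hF : F ∈ ksubsets n f) :
    lex F (insert e (Finset.Icc (n - f + 2) n)) ↔ ∃ y ∈ F, y ≤ e := by
  rw [ksubsets, ground, Finset.mem_powersetCard] at hF
  have hfn : f ≤ n := by
    have := Finset.card_le_card hF.1
    rw [Nat.card_Icc] at this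
    omega
  rw [Finset.insert_eq, lex_union_Icc_iff (q := e) (by simp) (by omega) hF.1]
  · constructor
    · rintro (h | ⟨y, hy, -, hye, -⟩)
      · exact ⟨e, h (by simp), le_rfl⟩
      · exact ⟨y, hy, hye.le⟩
    · rintro ⟨y, hy, hye⟩
      rcases hye.lt_or_eq with h | rfl
      · refine Or.inr ⟨y, hy, by simp [h.ne], h, fun z hz hzy => ?_⟩
        rw [Finset.mem_singleton] at hz
        omega
      · exact Or.inl (by simpa using hy)
  · rw [← Finset.insert_eq, Finset.card_insert_of_notMem, Nat.card_Icc]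
    · omega
    · rw [Finset.mem_Icc]
      omega

theorem exists_pairMaximal_insert_succ {n f g q a : ℕ} {D : Finset ℕ} (hD : D ⊆ Finset.Icc 1 q)
    (hqa : q + 1 < a) (hqn : q + 1 ≤ n) (hfg : f + g ≤ n)
    (hf : (insert (q + 1) D ∪ Finset.Icc a n).card = f) (hsmall : q < D.card + g) :
    ∃ B ∈ ksubsets n g, PairMaximal n (insert (q + 1) D ∪ Finset.Icc a n) B := by
  have hqD : q + 1 ∉ D := fun h => by
    have := Finset.mem_Icc.mp (hD h)
    omega
  have hDsub : D ⊆ Finset.Icc 1 (q + 1) := hD.trans (Finset.Icc_subset_Icc_right (by omega))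
  have hDf : D.card + 1 ≤ f := by
    rw [← Finset.card_insert_of_notMem hqD, ← hf]
    exact Finset.card_le_card Finset.subset_union_left
  have hDq : D.card ≤ q := by simpa using Finset.card_le_card hD
  set P := Finset.Icc 1 (q + 1) \ D with hP
  have hPcard : P.card = q + 1 - D.card := by
    rw [hP, Finset.card_sdiff_of_subset hDsub, Nat.card_Icc]
    omega
  have hg : (P ∪ Finset.Icc (n - (g - P.card) + 1) n).card = g := by
    rw [Finset.card_union_of_disjoint, Nat.card_Icc]
    · omega
    · rw [Finset.disjoint_left]
      intro y hy hy'
      have := Finset.mem_Icc.mp (Finset.mem_sdiff.mp hy).1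
      have := Finset.mem_Icc.mp hy'
      omega
  refine ⟨P ∪ Finset.Icc (n - (g - P.card) + 1) n, ?_,
    pairMaximal_of_partners ?_ ?_ hqn hfg hqa (by omega) hf hg⟩
  · rw [ksubsets, ground, Finset.mem_powersetCard]
    refine ⟨Finset.union_subset (Finset.sdiff_subset.trans ?_) ?_, hg⟩
    · exact Finset.Icc_subset_Icc_right hqn
    · exact Finset.Icc_subset_Icc_left (by omega)
  · rw [Finset.insert_inter_of_mem (by simp [hP, hqD]), hP, Finset.inter_sdiff_self]
    rfl
  · rw [Finset.insert_union, hP, Finset.union_sdiff_of_subset hDsub]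
    exact Finset.insert_eq_of_mem (by simp)

theorem shift_tail_mem_F23 {n f g e x : ℕ} {A : Finset ℕ} (hfg : f + g ≤ n) (he : 1 ≤ e)
    (hef : e + f ≤ n) (hell : 1 ≤ ell n A) (hx : x ∈ A \ tailPart n A)
    (hxmax : ∀ y ∈ A \ tailPart n A, y ≤ x) (hmem : A ∈ F23 n f g e)
    (hAfirst : lexLT (insert 1 (Finset.Icc (n - f + 2) n)) A) :
    insert (x + 1) ((A \ tailPart n A) ∪ Finset.Icc (n - ell n A + 2) n) ∈ F23 n f g e := by
  rw [F23, Finset.mem_filter, R2fam, Finset.mem_filter] at hmem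
  obtain ⟨⟨hA, -, hAe⟩, B, hB, hAB⟩ := hmem
  have hAsub := hA
  rw [ksubsets, ground, Finset.mem_powersetCard] at hAsub
  obtain ⟨hAn, hAf⟩ := hAsub
  obtain ⟨hpn, htail⟩ := ell_le_and_tailPart_subset n A
  have hxA := (Finset.mem_sdiff.mp hx).1
  have hxn := Finset.mem_Icc.mp (hAn hxA)
  have hxp : x + 1 ≤ n - ell n A := by
    have hxt := (Finset.mem_sdiff.mp hx).2
    rw [tailPart, Finset.mem_Icc] at hxt
    have : x ≠ n - ell n A := fun h => sub_ell_notMem (by omega) (h ▸ hxA)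
    omega
  have hf : 1 ≤ f := hAf ▸ Finset.card_pos.mpr ⟨x, hxA⟩
  have hsplit : (A \ tailPart n A) ∪ tailPart n A = A := Finset.sdiff_union_of_subset htail
  have htcard : (tailPart n A).card = ell n A := by
    rw [tailPart, Nat.card_Icc]
    omega
  have hDcard : (A \ tailPart n A).card + ell n A = f := by
    rw [Finset.card_sdiff_of_subset htail, htcard, hAf]
    have := Finset.card_le_card htail
    omega
  have hD : A \ tailPart n A ⊆ Finset.Icc 1 x := fun y hy =>
    Finset.mem_Icc.mpr
      ⟨(Finset.mem_Icc.mp (hAn (Finset.mem_sdiff.mp hy).1)).1, hxmax y hy⟩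
  have hxyt : ∀ y ∈ tailPart n A, x < y := fun y hy => by
    rw [tailPart, Finset.mem_Icc] at hy
    omega
  generalize hDdef : A \ tailPart n A = D at *
  have hsplit' : D ∪ Finset.Icc (n - ell n A + 1) n = A := hsplit
  have hsmall : x < D.card + g := by
    refine lt_of_pairMaximal hD hx (a := n - ell n A + 1) (by omega) hfg ?_ (by omega) hB ?_
    · rw [hsplit', hAf]
    · rwa [hsplit']
  have hxD : x + 1 ∉ D := fun h => by
    have := hxmax _ h
    omega
  have hcard : (insert (x + 1) D ∪ Finset.Icc (n - ell n A + 2) n).card = f := by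
    rw [Finset.card_union_of_disjoint, Finset.card_insert_of_notMem hxD, Nat.card_Icc]
    · omega
    · rw [Finset.disjoint_left]
      intro y hy hy'
      rw [Finset.mem_Icc] at hy'
      rcases Finset.mem_insert.mp hy with rfl | hy
      · omega
      · have := hxmax y hy
        omega
  have hmem' : insert (x + 1) D ∪ Finset.Icc (n - ell n A + 2) n ∈ ksubsets n f := by
    rw [ksubsets, ground, Finset.mem_powersetCard]
    refine ⟨Finset.union_subset (Finset.insert_subset ?_ ?_) ?_, hcard⟩
    · exact Finset.mem_Icc.mpr (by omega)
    · exact hD.trans (Finset.Icc_subset_Icc_right hxn.2)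
    · exact Finset.Icc_subset_Icc_left (by omega)
  have hfirst_card : (insert 1 (Finset.Icc (n - f + 2) n)).card = f := by
    rw [Finset.card_insert_of_notMem, Nat.card_Icc]
    · omega
    · rw [Finset.mem_Icc]
      omega
  have hone : 1 ∉ A := fun h => hAfirst.2 <| eq_of_lex_of_lex (hfirst_card.trans hAf.symm)
    hAfirst.1 ((lex_insert_Icc_iff hf (by omega) hA).mpr ⟨1, h, le_rfl⟩)
  rw [← Finset.insert_union, F23, Finset.mem_filter, R2fam, Finset.mem_filter]
  refine ⟨⟨hmem', ?_, ?_⟩, exists_pairMaximal_insert_succ hD (by omega) (by omega) hfg hcard hsmall⟩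
  · refine (lex_union_Icc_iff (q := x + 1) ?_ (by omega) ?_
      (hfirst_card.trans hcard.symm)).mpr (Or.inr ⟨1, by simp, ?_, by omega, ?_⟩)
    · intro z hz
      rcases Finset.mem_insert.mp hz with rfl | hz
      · exact le_rfl
      · exact (hxmax z hz).trans (by omega)
    · refine Finset.insert_subset (Finset.mem_Icc.mpr (by omega)) ?_
      exact Finset.Icc_subset_Icc_left (by omega)
    · intro h
      rcases Finset.mem_insert.mp h with h | h
      · omega
      · exact hone (hsplit ▸ Finset.mem_union_left _ h)
    · intro z hz hz1
      rcases Finset.mem_insert.mp hz with rfl | hz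
      · omega
      · have := Finset.mem_Icc.mp (hD hz)
        omega
  · rw [lex_insert_Icc_iff hf (by omega) hmem']
    obtain ⟨y, hy, hye⟩ := (lex_insert_Icc_iff hf (by omega) hA).mp hAe
    rw [← hsplit, Finset.mem_union] at hy
    rcases hy with hy | hy
    · exact ⟨y, by simp [hy], hye⟩
    · exact ⟨x, by simp [hx], (hxyt y hy).le.trans hye⟩

/-- Claim 3.17: `ℱ₂,₃` is closed under shifting the first tail element:
replacing `A = {x₁,…,x_{k₂−p}} ∪ {n−p+1,…,n}` by
`A' = {x₁,…,x_{k₂−p}, x_{k₂−p}+1} ∪ {n−p+2,…,n}`. -/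
theorem F23_closed_shift_tail (n t : ℕ) (k : Fin t → ℕ)
    (ht : 3 ≤ t)
    (hanti : ∀ i j : Fin t, i ≤ j → k j ≤ k i)
    (h12 : k ⟨1, by omega⟩ < k ⟨0, by omega⟩)
    (hkt : 2 ≤ k ⟨t - 1, by omega⟩)
    (hn1 : k ⟨0, by omega⟩ + k ⟨2, by omega⟩ ≤ n)
    (hn2 : n < k ⟨0, by omega⟩ + k ⟨1, by omega⟩)
    (A : Finset ℕ) (p x : ℕ)
    (hA : A ∈ ksubsets n (k ⟨1, by omega⟩))
    (hp : ell n A = p) (hp1 : 1 ≤ p)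
    (hx : x ∈ A \ tailPart n A)
    (hxmax : ∀ y ∈ A \ tailPart n A, y ≤ x)
    (hmem : A ∈ F23 n (k ⟨1, by omega⟩) (k ⟨2, by omega⟩) (k ⟨t - 1, by omega⟩))
    (hAfirst : lexLT (insert 1 (Finset.Icc (n - k ⟨1, by omega⟩ + 2) n)) A) :
    insert (x + 1) ((A \ tailPart n A) ∪ Finset.Icc (n - p + 2) n) ∈
      F23 n (k ⟨1, by omega⟩) (k ⟨2, by omega⟩) (k ⟨t - 1, by omega⟩) := by
  have h23 : k ⟨t - 1, by omega⟩ ≤ k ⟨2, by omega⟩ := hanti _ _ (by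
    rw [Fin.mk_le_mk]
    omega)
  subst hp
  exact shift_tail_mem_F23 (by omega) (by omega) (by omega) hp1 hx hxmax hmem hAfirst
end
end
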